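/- arXiv:2601.22122 — 3 statements merged into one kernel-verified Lean document; each statement's English description precedes it below -/
import Mathlib

section
/- Let (G, G⁰, s, r, u, ι, m) be a quasi-Lie groupoid. Then: (1) the unit map u : G⁰ → G is a closed smooth embedding; (2) the inversion ι : G → G is a diffeomorphism; (3) the composition m : G² → G and the range map r : G → G⁰ are submersions, where G² = {(γ',γ) ∈ G × G : s(γ') = r(γ)} carries the subspace differential structure from G × G. -/
open scoped Topology

/-- A differential structure (in the sense of Sikorski and Aronszajn) on a topological space `M`:
a nonempty set of continuous complex-valued functions which separates points, is closed under
composition with infinitely `ℝ`-differentiable functions `ℂⁿ → ℂ`, and is local. -/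
structure IsDiffStructure (M : Type*) [TopologicalSpace M] (D : Set (M → ℂ)) : Prop where
  nonempty : D.Nonempty
  continuous : ∀ f ∈ D, Continuous f
  separates : ∀ x y : M, x ≠ y → ∃ f ∈ D, f x ≠ f y
  comp : ∀ (n : ℕ) (g : Fin n → (M → ℂ)), (∀ i, g i ∈ D) →
    ∀ F : (Fin n → ℂ) → ℂ, ContDiff ℝ (⊤ : ℕ∞) F → (fun x => F fun i => g i x) ∈ D
  locality : ∀ f : M → ℂ,
    (∀ x : M, ∃ U ∈ 𝓝 x, ∃ g ∈ D, ∀ y ∈ U, f y = g y) → f ∈ D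

/-- The differential structure induced on a subset `A ⊆ M`: functions that locally (on `A`)
agree with elements of `D`. -/
def restrictD {M : Type*} [TopologicalSpace M] (D : Set (M → ℂ)) (A : Set M) :
    Set (A → ℂ) :=
  {f | ∀ x : A, ∃ U : Set M, IsOpen U ∧ (x : M) ∈ U ∧
    ∃ g ∈ D, ∀ y : A, (y : M) ∈ U → f y = g y}

/-- The differential structure generated by a family `F` of functions: all functions which
locally agree with some smooth composite `G ∘ (g₁, …, gₙ)` of members of `F`. -/
def generatedD {M : Type*} [TopologicalSpace M] (F : Set (M → ℂ)) : Set (M → ℂ) :=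
  {f | ∀ x : M, ∃ U ∈ 𝓝 x, ∃ (n : ℕ) (g : Fin n → (M → ℂ)), (∀ i, g i ∈ F) ∧
    ∃ G : (Fin n → ℂ) → ℂ, ContDiff ℝ (⊤ : ℕ∞) G ∧ ∀ y ∈ U, f y = G fun i => g i y}

/-- The product differential structure on `M₁ × M₂`. -/
def prodD {M₁ M₂ : Type*} [TopologicalSpace M₁] [TopologicalSpace M₂]
    (D₁ : Set (M₁ → ℂ)) (D₂ : Set (M₂ → ℂ)) : Set (M₁ × M₂ → ℂ) :=
  generatedD ((fun f => f ∘ Prod.fst) '' D₁ ∪ (fun f => f ∘ Prod.snd) '' D₂)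

/-- The differential structure on `ℝⁿ`: all infinitely `ℝ`-differentiable functions to `ℂ`. -/
def euclD (n : ℕ) : Set ((Fin n → ℝ) → ℂ) := {f | ContDiff ℝ (⊤ : ℕ∞) f}

/-- A map between spaces with differential structures is smooth if it pulls back structure
functions to structure functions. -/
def DSmooth {M M' : Type*} (D : Set (M → ℂ)) (D' : Set (M' → ℂ)) (f : M → M') : Prop :=
  ∀ g ∈ D', (g ∘ f) ∈ D

/-- A diffeomorphism between spaces with differential structures: a smooth homeomorphism whose
inverse is smooth. -/
def IsDDiffeomorphism {M M' : Type*} [TopologicalSpace M] [TopologicalSpace M']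
    (D : Set (M → ℂ)) (D' : Set (M' → ℂ)) (f : M → M') : Prop :=
  IsHomeomorph f ∧ DSmooth D D' f ∧ ∀ g ∈ D, ∃ h ∈ D', ∀ x, h (f x) = g x

/-- A closed smooth embedding: a closed topological embedding which is a diffeomorphism onto
its image (with the restricted differential structure). -/
def IsClosedSmoothEmbedding {M M' : Type*} [TopologicalSpace M] [TopologicalSpace M']
    (D : Set (M → ℂ)) (D' : Set (M' → ℂ)) (f : M → M') : Prop :=
  Topology.IsClosedEmbedding f ∧
  (∀ h ∈ restrictD D' (Set.range f), (fun x => h ⟨f x, Set.mem_range_self x⟩) ∈ D) ∧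
  (∀ g ∈ D, ∃ h ∈ restrictD D' (Set.range f), ∀ x, h ⟨f x, Set.mem_range_self x⟩ = g x)

/-- An open smooth embedding: an open topological embedding which is a diffeomorphism onto
its image (with the restricted differential structure). -/
def IsOpenSmoothEmbedding {M M' : Type*} [TopologicalSpace M] [TopologicalSpace M']
    (D : Set (M → ℂ)) (D' : Set (M' → ℂ)) (f : M → M') : Prop :=
  Topology.IsOpenEmbedding f ∧
  (∀ h ∈ restrictD D' (Set.range f), (fun x => h ⟨f x, Set.mem_range_self x⟩) ∈ D) ∧
  (∀ g ∈ D, ∃ h ∈ restrictD D' (Set.range f), ∀ x, h ⟨f x, Set.mem_range_self x⟩ = g x)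

/-- `f` is a local diffeomorphism at `x` if its restriction to some open neighborhood of `x`
is an open smooth embedding. -/
def IsLocalDiffeoAt {M M' : Type*} [TopologicalSpace M] [TopologicalSpace M']
    (D : Set (M → ℂ)) (D' : Set (M' → ℂ)) (f : M → M') (x : M) : Prop :=
  ∃ U : Set M, IsOpen U ∧ x ∈ U ∧
    IsOpenSmoothEmbedding (restrictD D U) D' (fun y : U => f y)

/-- `f : M → M'` is a submersion at `x` if, together with some smooth `g : M → ℝⁿ`, the map
`y ↦ (f y, g y)` is a local diffeomorphism at `x`. -/
def DSubmersionAt {M M' : Type*} [TopologicalSpace M] [TopologicalSpace M']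
    (D : Set (M → ℂ)) (D' : Set (M' → ℂ)) (f : M → M') (x : M) : Prop :=
  ∃ (n : ℕ) (g : M → (Fin n → ℝ)), DSmooth D (euclD n) g ∧
    IsLocalDiffeoAt D (prodD D' (euclD n)) (fun y => (f y, g y)) x

/-- `f` is a submersion if it is a submersion at every point. -/
def DSubmersion {M M' : Type*} [TopologicalSpace M] [TopologicalSpace M']
    (D : Set (M → ℂ)) (D' : Set (M' → ℂ)) (f : M → M') : Prop :=
  ∀ x : M, DSubmersionAt D D' f x

/-- A differential space is locally finite-dimensional if every point has an open neighborhood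
`U` on which finitely many smooth functions generate `C^∞(U)`. -/
def LocallyFinDimD {M : Type*} [TopologicalSpace M] (D : Set (M → ℂ)) : Prop :=
  ∀ x : M, ∃ U : Set M, IsOpen U ∧ x ∈ U ∧ ∃ (n : ℕ) (f : Fin n → (U → ℂ)),
    (∀ i, f i ∈ restrictD D U) ∧ ∀ g ∈ restrictD D U, ∃ F : (Fin n → ℂ) → ℂ,
      ContDiff ℝ (⊤ : ℕ∞) F ∧ g = fun y => F fun i => f i y

section DifferentialSpaces

open Filter

variable {M N : Type*} [TopologicalSpace M] [TopologicalSpace N]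

theorem mem_restrictD_iff {D : Set (M → ℂ)} {A : Set M} {f : A → ℂ} :
    f ∈ restrictD D A ↔ ∀ x : A, ∃ g ∈ D, ∀ᶠ y in 𝓝 x, f y = g y := by
  constructor
  · intro hf x
    obtain ⟨U, hU, hx, g, hg, h⟩ := hf x
    exact ⟨g, hg, Filter.mem_of_superset
      ((hU.preimage continuous_subtype_val).mem_nhds hx) fun y hy => h y hy⟩
  · intro hf x
    obtain ⟨g, hg, h⟩ := hf x
    rw [nhds_subtype_eq_comap] at h
    obtain ⟨V, hV, hVh⟩ := Filter.mem_comap.1 h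
    obtain ⟨U, hUV, hU, hx⟩ := mem_nhds_iff.1 hV
    exact ⟨U, hU, hx, g, hg, fun y hy => hVh (hUV hy)⟩

theorem comp_val_mem_restrictD {D : Set (M → ℂ)} {f : M → ℂ} (hf : f ∈ D) (A : Set M) :
    (fun x : A => f x) ∈ restrictD D A :=
  mem_restrictD_iff.2 fun _ => ⟨f, hf, Eventually.of_forall fun _ => rfl⟩

theorem continuous_of_mem_restrictD {D : Set (M → ℂ)} (hD : ∀ f ∈ D, Continuous f) {A : Set M}
    {f : A → ℂ} (hf : f ∈ restrictD D A) : Continuous f := by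
  refine continuous_iff_continuousAt.2 fun x => ?_
  obtain ⟨g, hg, h⟩ := mem_restrictD_iff.1 hf x
  exact ((hD g hg).comp continuous_subtype_val).continuousAt.congr
    (h.mono fun _ hy => hy.symm)

theorem subset_generatedD (F : Set (M → ℂ)) : F ⊆ generatedD F := fun f hf _ =>
  ⟨Set.univ, univ_mem, 1, fun _ => f, fun _ => hf, fun v => v 0, contDiff_apply ℝ ℂ 0,
    fun _ _ => rfl⟩

theorem comp_mem_generatedD {F : Set (M → ℂ)} {n : ℕ} {f : Fin n → M → ℂ}
    (hf : ∀ i, f i ∈ generatedD F) {H : (Fin n → ℂ) → ℂ} (hH : ContDiff ℝ (⊤ : ℕ∞) H) :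
    (fun x => H fun i => f i x) ∈ generatedD F := by
  intro x
  choose U hU k g hg G hG hfG using fun i => hf i x
  let e := Fintype.equivFin (Σ i, Fin (k i))
  refine ⟨⋂ i, U i, Filter.iInter_mem.2 hU, _, fun j => g (e.symm j).1 (e.symm j).2,
    fun j => hg _ _, fun v => H fun i => G i fun j => v (e ⟨i, j⟩), ?_, ?_⟩
  · exact hH.comp (contDiff_pi.2 fun i =>
      (hG i).comp (contDiff_pi.2 fun j => contDiff_apply ℝ ℂ _))
  · intro y hy
    have hgj (i : Fin n) (j : Fin (k i)) :
        g (e.symm (e ⟨i, j⟩)).1 (e.symm (e ⟨i, j⟩)).2 y = g i j y := by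
      rw [Equiv.symm_apply_apply]
    refine congrArg H (funext fun i => ?_)
    exact (hfG i y (Set.mem_iInter.1 hy i)).trans
      (congrArg (G i) (funext fun j => (hgj i j).symm))

theorem continuous_of_mem_generatedD {F : Set (M → ℂ)} (hF : ∀ f ∈ F, Continuous f)
    {f : M → ℂ} (hf : f ∈ generatedD F) : Continuous f := by
  refine continuous_iff_continuousAt.2 fun x => ?_
  obtain ⟨U, hU, n, g, hg, G, hG, h⟩ := hf x
  exact (hG.continuous.comp (continuous_pi fun i => hF _ (hg i))).continuousAt.congr
    (mem_of_superset hU fun y hy => (h y hy).symm)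

/-- To compare germs of functions along `φ` with germs along `ψ`, it suffices to do so on
generators. -/
theorem exists_mem_generatedD_eventuallyEq {X : Type*} {F : Set (M → ℂ)} {F' : Set (N → ℂ)}
    {l : Filter X} {φ : X → N} {ψ : X → M} {x : N} (hφ : Tendsto φ l (𝓝 x))
    (h : ∀ k ∈ F', ∃ k' ∈ generatedD F, ∀ᶠ w in l, k (φ w) = k' (ψ w))
    {k : N → ℂ} (hk : k ∈ generatedD F') :
    ∃ k' ∈ generatedD F, ∀ᶠ w in l, k (φ w) = k' (ψ w) := by
  obtain ⟨U, hU, n, g, hg, H, hH, hkH⟩ := hk x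
  choose g' hg' hgg' using fun i => h (g i) (hg i)
  refine ⟨_, comp_mem_generatedD hg' hH, ?_⟩
  filter_upwards [hφ hU, Filter.eventually_all.2 hgg'] with w hw hw'
  rw [hkH _ hw]
  simp only [hw']

theorem comp_fst_mem_prodD {D : Set (M → ℂ)} {f : M → ℂ} (hf : f ∈ D) (D' : Set (N → ℂ)) :
    (fun p => f p.1) ∈ prodD D D' :=
  subset_generatedD _ (Or.inl ⟨f, hf, rfl⟩)

theorem comp_snd_mem_prodD (D : Set (M → ℂ)) {D' : Set (N → ℂ)} {f : N → ℂ} (hf : f ∈ D') :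
    (fun p => f p.2) ∈ prodD D D' :=
  subset_generatedD _ (Or.inr ⟨f, hf, rfl⟩)

theorem continuous_of_mem_prodD {D : Set (M → ℂ)} {D' : Set (N → ℂ)}
    (hD : ∀ f ∈ D, Continuous f) (hD' : ∀ f ∈ D', Continuous f) {f : M × N → ℂ}
    (hf : f ∈ prodD D D') : Continuous f := by
  refine continuous_of_mem_generatedD ?_ hf
  rintro _ (⟨k, hk, rfl⟩ | ⟨k, hk, rfl⟩)
  · exact (hD k hk).comp continuous_fst
  · exact (hD' k hk).comp continuous_snd

theorem DSmooth.continuous_eucl {D : Set (M → ℂ)} (hD : ∀ f ∈ D, Continuous f) {n : ℕ}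
    {g : M → Fin n → ℝ} (hg : DSmooth D (euclD n) g) : Continuous g := by
  refine continuous_pi fun i => ?_
  have hi : (fun v : Fin n → ℝ => (v i : ℂ)) ∈ euclD n :=
    (Complex.ofRealCLM.contDiff.comp (contDiff_apply ℝ ℝ i) :
      ContDiff ℝ (⊤ : ℕ∞) (Complex.ofRealCLM ∘ fun v : Fin n → ℝ => v i))
  simpa [Function.comp_def] using Complex.continuous_re.comp (hD _ (hg _ hi))

namespace IsDiffStructure

variable {D : Set (M → ℂ)}

theorem const_mem (hD : IsDiffStructure M D) (c : ℂ) : (fun _ => c) ∈ D :=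
  hD.comp 0 Fin.elim0 (fun i => i.elim0) (fun _ => c) contDiff_const

theorem comp_one (hD : IsDiffStructure M D) {f : M → ℂ} (hf : f ∈ D) {H : ℂ → ℂ}
    (hH : ContDiff ℝ (⊤ : ℕ∞) H) : (fun x => H (f x)) ∈ D :=
  hD.comp 1 (fun _ => f) (fun _ => hf) (fun v => H (v 0)) (hH.comp (contDiff_apply ℝ ℂ 0))

theorem mul_mem (hD : IsDiffStructure M D) {f g : M → ℂ} (hf : f ∈ D) (hg : g ∈ D) :
    (fun x => f x * g x) ∈ D := by
  have h := hD.comp 2 ![f, g] (by intro i; fin_cases i <;> assumption) (fun v => v 0 * v 1)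
    ((contDiff_apply ℝ ℂ 0).mul (contDiff_apply ℝ ℂ 1))
  simpa using h

theorem exists_eq_one_eventually_zero (hD : IsDiffStructure M D) {x y : M} (hxy : x ≠ y) :
    ∃ k ∈ D, k x = 1 ∧ ∀ᶠ z in 𝓝 y, k z = 0 := by
  obtain ⟨f, hf, hne⟩ := hD.separates x y hxy
  have hd : 0 < dist (f y) (f x) := dist_pos.2 hne.symm
  let b : ContDiffBump (f x) := ⟨dist (f y) (f x) / 4, dist (f y) (f x) / 2, by positivity,
    by linarith⟩
  refine ⟨_, hD.comp_one hf (H := fun w => (b w : ℂ))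
    (Complex.ofRealCLM.contDiff.comp b.contDiff), ?_, ?_⟩
  · simp [b.one_of_mem_closedBall (Metric.mem_closedBall_self b.rIn_pos.le)]
  · have hopen : IsOpen {z | b.rOut < dist (f z) (f x)} :=
      isOpen_lt continuous_const ((hD.continuous f hf).dist continuous_const)
    refine mem_of_superset (hopen.mem_nhds (?_ : b.rOut < _)) fun z hz => ?_
    · change dist (f y) (f x) / 2 < _
      linarith
    · simp [b.zero_of_le_dist (le_of_lt hz)]

theorem exists_eq_one_zero_nhdsSet (hD : IsDiffStructure M D) {x : M} {B : Set M}
    (hB : IsCompact B) (hx : x ∉ B) : ∃ k ∈ D, k x = 1 ∧ ∀ᶠ z in 𝓝ˢ B, k z = 0 := by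
  simp only [eventually_nhdsSet_iff_exists]
  refine hB.induction_on (p := fun S => ∃ k ∈ D, k x = 1 ∧ ∃ O, IsOpen O ∧ S ⊆ O ∧
    ∀ z ∈ O, k z = 0) ?_ ?_ ?_ ?_
  · exact ⟨_, hD.const_mem 1, rfl, ∅, isOpen_empty, subset_rfl, fun _ h => h.elim⟩
  · rintro S T hST ⟨k, hk, hkx, O, hO, hTO, h⟩
    exact ⟨k, hk, hkx, O, hO, hST.trans hTO, h⟩
  · rintro S T ⟨k, hk, hkx, O, hO, hSO, h⟩ ⟨k', hk', hkx', O', hO', hTO', h'⟩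
    refine ⟨_, hD.mul_mem hk hk', by simp [hkx, hkx'], O ∪ O', hO.union hO',
      Set.union_subset_union hSO hTO', ?_⟩
    rintro z (hz | hz)
    · simp [h z hz]
    · simp [h' z hz]
  · intro y hy
    obtain ⟨k, hk, hkx, h⟩ := hD.exists_eq_one_eventually_zero (ne_of_mem_of_not_mem hy hx).symm
    obtain ⟨O, hOk, hO, hyO⟩ := mem_nhds_iff.1 h
    exact ⟨O, mem_nhdsWithin_of_mem_nhds (hO.mem_nhds hyO), k, hk, hkx, O, hO, subset_rfl,
      fun z hz => hOk hz⟩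

theorem exists_bump [T2Space M] [LocallyCompactSpace M] (hD : IsDiffStructure M D) {x : M}
    {V : Set M} (hV : V ∈ 𝓝 x) : ∃ k ∈ D, k x = 1 ∧ ∀ y ∉ V, k y = 0 := by
  classical
  obtain ⟨K, hK, hKV, hKc⟩ := local_compact_nhds hV
  have hKcl := hKc.isClosed
  obtain ⟨k, hk, hkx, h⟩ := hD.exists_eq_one_zero_nhdsSet
    (hKc.of_isClosed_subset isClosed_frontier hKcl.frontier_subset)
    (fun hx : x ∈ frontier K => hx.2 (mem_interior_iff_mem_nhds.2 hK))
  refine ⟨fun y => if y ∈ K then k y else 0, hD.locality _ fun z => ?_, ?_, ?_⟩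
  · by_cases hzK : z ∈ K
    · by_cases hzi : z ∈ interior K
      · exact ⟨K, mem_interior_iff_mem_nhds.1 hzi, k, hk, fun y hy => if_pos hy⟩
      · refine ⟨_, eventually_nhdsSet_iff_forall.1 h z ⟨subset_closure hzK, hzi⟩, _,
          hD.const_mem 0, fun y hy => ?_⟩
        have hy : k y = 0 := hy
        simp [hy]
    · exact ⟨Kᶜ, hKcl.isOpen_compl.mem_nhds hzK, _, hD.const_mem 0, fun y hy => if_neg hy⟩
  · simp [mem_of_mem_nhds hK, hkx]
  · intro y hy
    exact if_neg fun h => hy (hKV h)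

/-- Smooth maps into a differential space are continuous. -/
theorem continuous_of_dSmooth [T2Space M] [LocallyCompactSpace M] (hD : IsDiffStructure M D)
    {D' : Set (N → ℂ)} (hD' : ∀ f ∈ D', Continuous f) {φ : N → M} (hφ : DSmooth D' D φ) :
    Continuous φ := by
  refine continuous_iff_continuousAt.2 fun x V hV => ?_
  obtain ⟨k, hk, hkx, h⟩ := hD.exists_bump hV
  have hopen : IsOpen {y | k (φ y) ≠ 0} :=
    isOpen_ne.preimage (hD' _ (hφ k hk))
  refine mem_map.2 <| mem_of_superset (hopen.mem_nhds (?_ : k (φ x) ≠ 0)) fun y hy => ?_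
  · simp [hkx]
  by_contra hyV
  exact hy (h _ hyV)

end IsDiffStructure

theorem isLocalDiffeoAt_iff {D : Set (M → ℂ)} {D' : Set (N → ℂ)} {f : M → N} {x : M} :
    IsLocalDiffeoAt D D' f x ↔ ∃ U : Set M, IsOpen U ∧ x ∈ U ∧
      Topology.IsOpenEmbedding (fun y : U => f y) ∧
      (∀ h ∈ D', ∀ z ∈ U, ∃ k ∈ D, ∀ᶠ w in 𝓝 z, h (f w) = k w) ∧
      (∀ k ∈ D, ∀ z ∈ U, ∃ h ∈ D', ∀ᶠ w in 𝓝 z, k w = h (f w)) := by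
  refine exists_congr fun U => and_congr_right fun hU => and_congr_right fun _ =>
    and_congr_right fun he => ?_
  have hnhds {z : M} (hz : z ∈ U) {p : M → Prop} :
      (∀ᶠ w : U in 𝓝 ⟨z, hz⟩, p w) ↔ ∀ᶠ w in 𝓝 z, p w := by
    rw [← hU.isOpenEmbedding_subtypeVal.map_nhds_eq ⟨z, hz⟩, eventually_map]
  have hrange {z : U} {p : N → Prop} :
      (∀ᶠ w : Set.range (fun y : U => f y) in 𝓝 ⟨f z, Set.mem_range_self z⟩, p w) ↔
        ∀ᶠ w : U in 𝓝 z, p (f w) := by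
    have h1 := he.isOpen_range.isOpenEmbedding_subtypeVal.map_nhds_eq
      ⟨f z, Set.mem_range_self z⟩
    have h2 := he.map_nhds_eq z
    rw [← eventually_map (m := Subtype.val) (P := p), h1, ← h2, eventually_map]
  constructor
  · rintro ⟨h1, h2⟩
    refine ⟨fun h hh z hz => ?_, fun k hk z hz => ?_⟩
    · obtain ⟨k, hk, hkz⟩ := mem_restrictD_iff.1 (h1 _ (comp_val_mem_restrictD hh _)) ⟨z, hz⟩
      exact ⟨k, hk, (hnhds hz (p := fun w => h (f w) = k w)).1 hkz⟩
    · obtain ⟨h, hh, hhk⟩ := h2 _ (comp_val_mem_restrictD hk U)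
      obtain ⟨h', hh', hz'⟩ := mem_restrictD_iff.1 hh ⟨f z, Set.mem_range_self (⟨z, hz⟩ : U)⟩
      refine ⟨h', hh', (hnhds hz (p := fun w => k w = h' (f w))).1 ?_⟩
      have hc : Tendsto (Set.rangeFactorization fun y : U => f y) (𝓝 (⟨z, hz⟩ : U))
          (𝓝 ⟨f z, Set.mem_range_self (f := fun y : U => f y) ⟨z, hz⟩⟩) :=
        (he.continuous.subtype_mk _).tendsto (⟨z, hz⟩ : U)
      filter_upwards [hc hz'] with w hw
      exact (hhk w).symm.trans hw
  · rintro ⟨h1, h2⟩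
    refine ⟨fun h hh => mem_restrictD_iff.2 fun z => ?_, fun k hk => ?_⟩
    · obtain ⟨h', hh', hz'⟩ := mem_restrictD_iff.1 hh ⟨f z, Set.mem_range_self z⟩
      obtain ⟨k, hk, hkz⟩ := h1 h' hh' z z.2
      refine ⟨k, hk, ?_⟩
      have hc : Tendsto (Set.rangeFactorization fun y : U => f y) (𝓝 z)
          (𝓝 ⟨f z, Set.mem_range_self z⟩) := (he.continuous.subtype_mk _).tendsto _
      filter_upwards [hc hz', (hnhds z.2 (p := fun w => h' (f w) = k w)).2 hkz] with w hw hw'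
      exact hw.trans hw'
    · let e := Equiv.ofInjective _ he.injective
      have he' (z : U) : e.symm ⟨f z, Set.mem_range_self z⟩ = z := e.symm_apply_apply z
      refine ⟨fun y => k (e.symm y), mem_restrictD_iff.2 ?_, fun z => congrArg k (he' z)⟩
      rintro ⟨_, z, rfl⟩
      obtain ⟨k', hk', hkk'⟩ := mem_restrictD_iff.1 hk z
      obtain ⟨h, hh, hz⟩ := h2 k' hk' z z.2
      refine ⟨h, hh, ?_⟩
      have key : ∀ᶠ w : U in 𝓝 z, ∃ hw : f w ∈ Set.range (fun y : U => f y),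
          k (e.symm ⟨f w, hw⟩) = h (f w) := by
        filter_upwards [hkk', (hnhds z.2 (p := fun w => k' w = h (f w))).2 hz] with w hw hw'
        exact ⟨Set.mem_range_self w, (congrArg k (he' w)).trans (hw.trans hw')⟩
      exact (hrange (p := fun y => ∃ hy : y ∈ Set.range (fun y : U => f y),
        k (e.symm ⟨y, hy⟩) = h y)).2 key |>.mono fun y hy => hy.2

theorem DSubmersionAt.comp_involutive {D : Set (M → ℂ)} {D' : Set (N → ℂ)} {f : M → N} {x : M}
    {φ : M → M} (hφ : φ.Involutive) (hφc : Continuous φ) (hφs : DSmooth D D φ)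
    (hf : DSubmersionAt D D' f (φ x)) : DSubmersionAt D D' (f ∘ φ) x := by
  obtain ⟨n, g, hg, hloc⟩ := hf
  obtain ⟨U, hU, hx, he, h1, h2⟩ := isLocalDiffeoAt_iff.1 hloc
  refine ⟨n, g ∘ φ, fun k hk => hφs _ (hg k hk), isLocalDiffeoAt_iff.2
    ⟨φ ⁻¹' U, hU.preimage hφc, hx, ?_, fun h hh z hz => ?_, fun k hk z hz => ?_⟩⟩
  · let Φ : M ≃ₜ M := ⟨hφ.toPerm φ, hφc, hφc⟩
    exact he.comp (Φ.isOpenEmbedding.restrictPreimage U)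
  · obtain ⟨k, hk, hkz⟩ := h1 h hh (φ z) hz
    exact ⟨k ∘ φ, hφs k hk, hφc.continuousAt.eventually hkz⟩
  · obtain ⟨h, hh, hz'⟩ := h2 (k ∘ φ) (hφs k hk) (φ z) hz
    refine ⟨h, hh, (hφc.continuousAt.eventually hz').mono fun w hw => ?_⟩
    simpa [hφ w] using hw

/-- The pullback of a submersion is a submersion. -/
theorem DSubmersion.fst_fibreProduct {L : Type*} [TopologicalSpace L] {DM : Set (M → ℂ)}
    {DN : Set (N → ℂ)} {DL : Set (L → ℂ)} (hDN : ∀ f ∈ DN, Continuous f) {s : M → L} {r : N → L}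
    (hs : DSmooth DM DL s) (hsc : Continuous s) (hr : DSubmersion DN DL r) :
    DSubmersion (restrictD (prodD DM DN) {p : M × N | s p.1 = r p.2}) DM
      (fun p => p.val.1) := by
  intro x
  obtain ⟨n, g, hg, hloc⟩ := hr x.val.2
  obtain ⟨U, hU, hx, he, -, h2⟩ := isLocalDiffeoAt_iff.1 hloc
  have hgc := hg.continuous_eucl hDN
  have hfst : Continuous fun p : {p : M × N | s p.1 = r p.2} => p.val.1 :=
    continuous_fst.comp continuous_subtype_val
  have hsnd : Continuous fun p : {p : M × N | s p.1 = r p.2} => p.val.2 :=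
    continuous_snd.comp continuous_subtype_val
  have hψ := hfst.prodMk (hgc.comp hsnd)
  refine ⟨n, fun p => g p.val.2,
    fun k hk => comp_val_mem_restrictD (comp_snd_mem_prodD DM (hg k hk)) _,
    isLocalDiffeoAt_iff.2 ⟨_, hU.preimage hsnd, hx, ?_, fun h hh z hz => ?_,
      fun k hk z hz => ?_⟩⟩
  · refine .of_continuous_injective_isOpenMap (hψ.comp continuous_subtype_val) ?_ ?_
    · rintro ⟨⟨⟨a, b⟩, hab⟩, hb⟩ ⟨⟨⟨a', b'⟩, hab'⟩, hb'⟩ heq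
      simp only [Prod.mk.injEq] at heq
      obtain ⟨rfl, hgb⟩ := heq
      have := he.injective (a₁ := ⟨b, hb⟩) (a₂ := ⟨b', hb'⟩)
        (Prod.ext (Eq.trans (Eq.symm hab) hab') hgb)
      obtain rfl : b = b' := congrArg Subtype.val this
      rfl
    · refine isOpenMap_iff_nhds_le.2 ?_
      rintro ⟨⟨⟨a, b⟩, hab⟩, hb⟩ S hS
      rw [mem_map, nhds_subtype_eq_comap, nhds_subtype_eq_comap, comap_comap, nhds_prod_eq] at hS
      obtain ⟨T, hT, hTS⟩ := mem_comap.1 hS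
      obtain ⟨A, hA, B, hB, hABT⟩ := mem_prod_iff.1 hT
      have hB' : (fun y : U => (r y, g y)) '' (Subtype.val ⁻¹' B) ∈ 𝓝 (s a, g b) := by
        have := he.isOpenMap.image_mem_nhds
          (continuous_subtype_val.continuousAt.preimage_mem_nhds (x := (⟨b, hb⟩ : U)) hB)
        rwa [show s a = r b from hab]
      have hc : Continuous fun q : M × (Fin n → ℝ) => (s q.1, q.2) :=
        (hsc.comp continuous_fst).prodMk continuous_snd
      filter_upwards [hc.continuousAt.preimage_mem_nhds (x := (a, g b)) hB',
        continuous_fst.continuousAt.preimage_mem_nhds (x := (a, g b)) hA]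
      rintro ⟨a', v⟩ ⟨⟨b', hb'U⟩, hb', heq⟩ ha'
      simp only [Prod.mk.injEq] at heq
      obtain ⟨hrs, rfl⟩ := heq
      exact hTS (show (⟨⟨(a', b'), hrs.symm⟩, hb'U⟩ : Subtype _) ∈ _ from hABT ⟨ha', hb'⟩)
  · have hgen : ∀ l ∈ (fun f => f ∘ Prod.fst) '' DM ∪ (fun f => f ∘ Prod.snd) '' euclD n,
        ∃ k ∈ prodD DM DN, ∀ᶠ w : {p : M × N | s p.1 = r p.2} in 𝓝 z,
          l (w.val.1, g w.val.2) = k w.val := by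
      rintro _ (⟨k, hk, rfl⟩ | ⟨k, hk, rfl⟩)
      · exact ⟨_, comp_fst_mem_prodD hk _, Eventually.of_forall fun _ => rfl⟩
      · exact ⟨_, comp_snd_mem_prodD _ (hg k hk), Eventually.of_forall fun _ => rfl⟩
    obtain ⟨k, hk, hkz⟩ := exists_mem_generatedD_eventuallyEq (hψ.tendsto z) hgen hh
    exact ⟨_, comp_val_mem_restrictD hk _, hkz⟩
  · have hbase : ∀ l ∈ (fun f => f ∘ Prod.fst) '' DL ∪ (fun f => f ∘ Prod.snd) '' euclD n,
        ∃ h ∈ prodD DM (euclD n), ∀ᶠ w : {p : M × N | s p.1 = r p.2} in 𝓝 z,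
          l (s w.val.1, g w.val.2) = h (w.val.1, g w.val.2) := by
      rintro _ (⟨k, hk, rfl⟩ | ⟨k, hk, rfl⟩)
      · exact ⟨_, comp_fst_mem_prodD (hs k hk) _, Eventually.of_forall fun _ => rfl⟩
      · exact ⟨_, comp_snd_mem_prodD _ hk, Eventually.of_forall fun _ => rfl⟩
    have hgen : ∀ l ∈ (fun f => f ∘ Prod.fst) '' DM ∪ (fun f => f ∘ Prod.snd) '' DN,
        ∃ h ∈ prodD DM (euclD n), ∀ᶠ w : {p : M × N | s p.1 = r p.2} in 𝓝 z,
          l w.val = h (w.val.1, g w.val.2) := by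
      rintro _ (⟨k, hk, rfl⟩ | ⟨k, hk, rfl⟩)
      · exact ⟨_, comp_fst_mem_prodD hk _, Eventually.of_forall fun _ => rfl⟩
      · obtain ⟨l, hl, hlz⟩ := h2 k hk z.val.2 hz
        obtain ⟨h, hh, hhz⟩ := exists_mem_generatedD_eventuallyEq
          (((hsc.comp hfst).prodMk (hgc.comp hsnd)).tendsto z) hbase hl
        refine ⟨h, hh, ((hsnd.tendsto z).eventually hlz |>.and hhz).mono ?_⟩
        rintro ⟨⟨a, b⟩, hab⟩ ⟨hw, hw'⟩
        have hab : s a = r b := hab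
        simp only [Function.comp_apply, hab] at hw hw' ⊢
        exact hw.trans hw'
    obtain ⟨k', hk', hkz⟩ := mem_restrictD_iff.1 hk z
    obtain ⟨h, hh, hhz⟩ := exists_mem_generatedD_eventuallyEq
      (continuous_subtype_val.tendsto z) hgen hk'
    exact ⟨h, hh, (hkz.and hhz).mono fun w hw => hw.1.trans hw.2⟩

/-- A smooth map with a smooth left inverse is a closed smooth embedding. -/
theorem isClosedSmoothEmbedding_of_leftInverse [T2Space N] {D : Set (M → ℂ)} {D' : Set (N → ℂ)}
    (hD : IsDiffStructure M D) {f : M → N} {g : N → M} (hgf : Function.LeftInverse g f)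
    (hf : DSmooth D D' f) (hg : DSmooth D' D g) (hfc : Continuous f) (hgc : Continuous g) :
    IsClosedSmoothEmbedding D D' f := by
  refine ⟨hgf.isClosedEmbedding hgc hfc, fun h hh => hD.locality _ fun x => ?_, fun k hk =>
    ⟨_, comp_val_mem_restrictD (hg k hk) _, fun x => congrArg k (hgf x)⟩⟩
  obtain ⟨h', hh', hx⟩ := mem_restrictD_iff.1 hh ⟨f x, Set.mem_range_self x⟩
  exact ⟨_, (hfc.subtype_mk Set.mem_range_self).continuousAt.eventually hx, _, hf h' hh',
    fun y hy => hy⟩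

/-- A map into a subspace of a product is smooth when its two components are. -/
theorem DSmooth.subspace_prod {X : Type*} [TopologicalSpace X] {F : Set (X → ℂ)}
    {DM : Set (M → ℂ)} {DN : Set (N → ℂ)} {A : Set X} {B : Set (M × N)} {φ : A → B}
    (hφ : Continuous φ) (h1 : DSmooth (restrictD (generatedD F) A) DM fun p => (φ p).val.1)
    (h2 : DSmooth (restrictD (generatedD F) A) DN fun p => (φ p).val.2) :
    DSmooth (restrictD (generatedD F) A) (restrictD (prodD DM DN) B) φ := by
  refine fun k hk => mem_restrictD_iff.2 fun x => ?_
  obtain ⟨k', hk', hkx⟩ := mem_restrictD_iff.1 hk (φ x)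
  have hgen : ∀ k ∈ (fun f => f ∘ Prod.fst) '' DM ∪ (fun f => f ∘ Prod.snd) '' DN,
      ∃ l ∈ generatedD F, ∀ᶠ w in 𝓝 x, k (φ w) = l w := by
    rintro _ (⟨k, hk, rfl⟩ | ⟨k, hk, rfl⟩)
    · exact mem_restrictD_iff.1 (h1 k hk) x
    · exact mem_restrictD_iff.1 (h2 k hk) x
  obtain ⟨l, hl, hlx⟩ := exists_mem_generatedD_eventuallyEq
    ((continuous_subtype_val.comp hφ).tendsto x) hgen hk'
  exact ⟨l, hl, ((hφ.tendsto x).eventually hkx |>.and hlx).mono fun w hw => hw.1.trans hw.2⟩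

end DifferentialSpaces

/-- For a quasi-Lie groupoid (a groupoid whose spaces of arrows and objects are locally
finite-dimensional differential spaces, with smooth structure maps and submersive source):
the unit map is a closed smooth embedding, inversion is a diffeomorphism, and composition and
the range map are submersions. -/
theorem stmt_3
    {G : Type*} [TopologicalSpace G] [T2Space G] [LocallyCompactSpace G]
    [SecondCountableTopology G]
    {G0 : Type*} [TopologicalSpace G0] [T2Space G0] [LocallyCompactSpace G0]
    [SecondCountableTopology G0]
    (DG : Set (G → ℂ)) (DG0 : Set (G0 → ℂ))
    (hDG : IsDiffStructure G DG) (hDG0 : IsDiffStructure G0 DG0)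
    (hfdG : LocallyFinDimD DG) (hfdG0 : LocallyFinDimD DG0)
    (s r : G → G0) (u : G0 → G) (inv : G → G)
    (m : {p : G × G // s p.1 = r p.2} → G)
    -- groupoid axioms
    (hsu : ∀ x, s (u x) = x) (hru : ∀ x, r (u x) = x)
    (hsm : ∀ p : {p : G × G // s p.1 = r p.2}, s (m p) = s p.val.2)
    (hrm : ∀ p : {p : G × G // s p.1 = r p.2}, r (m p) = r p.val.1)
    (hunit_left : ∀ (γ : G) (h : s (u (r γ)) = r γ), m ⟨(u (r γ), γ), h⟩ = γ)
    (hunit_right : ∀ (γ : G) (h : s γ = r (u (s γ))), m ⟨(γ, u (s γ)), h⟩ = γ)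
    (hassoc : ∀ (γ'' γ' γ : G) (h1 : s γ'' = r γ') (h2 : s γ' = r γ)
      (h3 : s (m ⟨(γ'', γ'), h1⟩) = r γ) (h4 : s γ'' = r (m ⟨(γ', γ), h2⟩)),
      m ⟨(m ⟨(γ'', γ'), h1⟩, γ), h3⟩ = m ⟨(γ'', m ⟨(γ', γ), h2⟩), h4⟩)
    (hsinv : ∀ γ, s (inv γ) = r γ) (hrinv : ∀ γ, r (inv γ) = s γ)
    (hinv_mul : ∀ (γ : G) (h : s (inv γ) = r γ), m ⟨(inv γ, γ), h⟩ = u (s γ))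
    (hmul_inv : ∀ (γ : G) (h : s γ = r (inv γ)), m ⟨(γ, inv γ), h⟩ = u (r γ))
    -- smoothness hypotheses
    (hu_smooth : DSmooth DG0 DG u)
    (hs_smooth : DSmooth DG DG0 s) (hr_smooth : DSmooth DG DG0 r)
    (hinv_smooth : DSmooth DG DG inv)
    (hm_smooth : DSmooth (restrictD (prodD DG DG) {p : G × G | s p.1 = r p.2}) DG
      (fun p : {p : G × G | s p.1 = r p.2} => m ⟨p.val, p.prop⟩))
    (hs_sub : DSubmersion DG DG0 s) :
    IsClosedSmoothEmbedding DG0 DG u ∧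
    IsDDiffeomorphism DG DG inv ∧
    DSubmersion (restrictD (prodD DG DG) {p : G × G | s p.1 = r p.2}) DG
      (fun p : {p : G × G | s p.1 = r p.2} => m ⟨p.val, p.prop⟩) ∧
    DSubmersion DG DG0 r := by
  have hcG := hDG.continuous
  have hsc := hDG0.continuous_of_dSmooth hcG hs_smooth
  have huc := hDG.continuous_of_dSmooth hDG0.continuous hu_smooth
  have hic := hDG.continuous_of_dSmooth hcG hinv_smooth
  have hmc := hDG.continuous_of_dSmooth
    (fun _ => continuous_of_mem_restrictD fun _ => continuous_of_mem_prodD hcG hcG) hm_smooth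
  -- congruence for the partial composition
  have hm_congr {a a' b b' : G} (ha : a = a') (hb : b = b') (h : s a = r b) (h' : s a' = r b') :
      m ⟨(a, b), h⟩ = m ⟨(a', b'), h'⟩ := by subst ha hb; rfl
  have hinv : inv.Involutive := fun γ => by
    have h1 : s (inv (inv γ)) = r (inv γ) := hsinv _
    have h2 : s (inv γ) = r γ := hsinv _
    have h3 : s (m ⟨(inv (inv γ), inv γ), h1⟩) = r γ := (hsm _).trans h2
    have h4 : s (inv (inv γ)) = r (m ⟨(inv γ, γ), h2⟩) := h1.trans (hrm ⟨(inv γ, γ), h2⟩).symm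
    have h5 : s (inv (inv γ)) = s γ := h1.trans (hrinv γ)
    calc inv (inv γ) = m ⟨(inv (inv γ), u (s (inv (inv γ)))), (hru _).symm⟩ :=
          (hunit_right _ _).symm
      _ = m ⟨(inv (inv γ), m ⟨(inv γ, γ), h2⟩), h4⟩ :=
          hm_congr rfl (by rw [hinv_mul, h5]) _ _
      _ = m ⟨(m ⟨(inv (inv γ), inv γ), h1⟩, γ), h3⟩ := (hassoc _ _ _ _ _ _ _).symm
      _ = m ⟨(u (r γ), γ), hsu _⟩ := hm_congr (by rw [hinv_mul _ h1, h2]) rfl _ _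
      _ = γ := hunit_left _ _
  have hr_sub : DSubmersion DG DG0 r := by
    have hrs : r = s ∘ inv := funext fun γ => (hsinv γ).symm
    rw [hrs]
    exact fun γ => (hs_sub (inv γ)).comp_involutive hinv hic hinv_smooth
  refine ⟨isClosedSmoothEmbedding_of_leftInverse hDG0 hsu hu_smooth hs_smooth huc hsc,
    ⟨(⟨hinv.toPerm inv, hic, hic⟩ : G ≃ₜ G).isHomeomorph, hinv_smooth, fun g hg =>
      ⟨g ∘ inv, hinv_smooth g hg, fun x => congrArg g (hinv x)⟩⟩, ?_, hr_sub⟩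
  let φ (p : {p : G × G | s p.1 = r p.2}) : {p : G × G | s p.1 = r p.2} :=
    ⟨(m ⟨p.val, p.prop⟩, inv p.val.2), (hsm _).trans (hrinv _).symm⟩
  have hφ : φ.Involutive := by
    rintro ⟨⟨a, b⟩, hab⟩
    have hab : s a = r b := hab
    have h1 : s b = r (inv b) := (hrinv b).symm
    have h2 : s (m ⟨(a, b), hab⟩) = r (inv b) := (hsm _).trans h1
    have h3 : s a = r (m ⟨(b, inv b), h1⟩) := hab.trans (hrm ⟨(b, inv b), h1⟩).symm
    refine Subtype.ext (Prod.ext ?_ (hinv b))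
    calc m ⟨(m ⟨(a, b), hab⟩, inv b), h2⟩ = m ⟨(a, m ⟨(b, inv b), h1⟩), h3⟩ :=
          hassoc _ _ _ _ _ _ _
      _ = m ⟨(a, u (s a)), (hru _).symm⟩ := hm_congr rfl (by rw [hmul_inv, hab]) _ _
      _ = a := hunit_right _ _
  have hφc : Continuous φ := (hmc.prodMk
    (hic.comp (continuous_snd.comp continuous_subtype_val))).subtype_mk _
  have hφs : DSmooth (restrictD (prodD DG DG) {p : G × G | s p.1 = r p.2})
      (restrictD (prodD DG DG) {p : G × G | s p.1 = r p.2}) φ :=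
    DSmooth.subspace_prod hφc hm_smooth fun k hk =>
      comp_val_mem_restrictD (comp_snd_mem_prodD DG (hinv_smooth k hk)) _
  exact fun p => DSubmersionAt.comp_involutive (φ := φ) hφ hφc hφs
    (DSubmersion.fst_fibreProduct hcG hs_smooth hsc hr_sub (φ p))
end

section
/- Let M be a finite-dimensional differential space, i.e. one admitting a closed smooth embedding into some ℝ^n, and let π : E → M be a real vector bundle over M such that the function x ↦ dim E_x is bounded on M. Then the C^∞(M,ℝ)-module C^∞(M,E) of smooth sections is finitely generated: there exist smooth sections s₁,…,s_m ∈ C^∞(M,E) such that every smooth section s ∈ C^∞(M,E) can be written as s = f₁s₁ + ⋯ + f_ms_m with f₁,…,f_m ∈ C^∞(M,ℝ). -/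
open scoped Topology

/-- Local triviality, with rank `k`, at a point `x`, of `π : E → M` endowed with fiberwise
addition `add` and scalar multiplication `smul`: over some open `U ∋ x` there is a
diffeomorphism `ℝᵏ × U → π⁻¹(U)` commuting with the projections and fiberwise linear (hence a
fiberwise linear isomorphism onto each fiber). -/
def IsLocalTrivAt {E M : Type*} [TopologicalSpace E] [TopologicalSpace M]
    (DE : Set (E → ℂ)) (DM : Set (M → ℂ)) (π : E → M)
    (add : E → E → E) (smul : ℝ → E → E) (x : M) (k : ℕ) : Prop :=
  ∃ U : Set M, IsOpen U ∧ x ∈ U ∧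
    ∃ φ : (Fin k → ℝ) × U → {e : E // π e ∈ U},
      IsDDiffeomorphism (prodD (euclD k) (restrictD DM U)) (restrictD DE {e : E | π e ∈ U}) φ ∧
      (∀ (v : Fin k → ℝ) (y : U), π (φ (v, y)).val = (y : M)) ∧
      (∀ (v w : Fin k → ℝ) (y : U), (φ (v + w, y)).val = add (φ (v, y)).val (φ (w, y)).val) ∧
      (∀ (a : ℝ) (v : Fin k → ℝ) (y : U), (φ (a • v, y)).val = smul a (φ (v, y)).val) ∧
      (∀ (y : U) (e : E), π e = (y : M) → ∃ v : Fin k → ℝ, (φ (v, y)).val = e) ∧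
      (∀ (y : U) (v w : Fin k → ℝ), (φ (v, y)).val = (φ (w, y)).val → v = w)

open Set Filter

section Germ

variable {M : Type*} [TopologicalSpace M] {D : Set (M → ℂ)}

/-- `f` agrees near `x` with a member of `D`. -/
def GermMem (D : Set (M → ℂ)) (f : M → ℂ) (x : M) : Prop :=
  ∃ h ∈ D, ∀ᶠ y in 𝓝 x, f y = h y

theorem GermMem.of_mem {f : M → ℂ} (hf : f ∈ D) (x : M) : GermMem D f x :=
  ⟨f, hf, Eventually.of_forall fun _ => rfl⟩

theorem GermMem.congr {f g : M → ℂ} {x : M} (hf : GermMem D f x)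
    (hfg : ∀ᶠ y in 𝓝 x, g y = f y) : GermMem D g x := by
  obtain ⟨h, hD, hh⟩ := hf
  exact ⟨h, hD, by filter_upwards [hh, hfg] with y h1 h2 using h2.trans h1⟩

theorem IsDiffStructure.mem_of_germMem (hD : IsDiffStructure M D) {f : M → ℂ}
    (hf : ∀ x, GermMem D f x) : f ∈ D := by
  refine hD.locality f fun x => ?_
  obtain ⟨h, hh, hU⟩ := hf x
  exact ⟨_, hU, h, hh, fun y hy => hy⟩

theorem IsDiffStructure.const_mem_s4 (hD : IsDiffStructure M D) (c : ℂ) : (fun _ => c) ∈ D := by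
  simpa using hD.comp 0 (fun i => i.elim0) (fun i => i.elim0) (fun _ => c) contDiff_const

theorem IsDiffStructure.germMem_comp (hD : IsDiffStructure M D) {x : M} {n : ℕ}
    {g : Fin n → M → ℂ} (hg : ∀ i, GermMem D (g i) x) {F : (Fin n → ℂ) → ℂ}
    (hF : ContDiff ℝ (⊤ : ℕ∞) F) : GermMem D (fun y => F fun i => g i y) x := by
  choose h hh hU using hg
  refine ⟨_, hD.comp n h hh F hF, ?_⟩
  filter_upwards [eventually_all.2 hU] with y hy
  simp only [hy]

theorem IsDiffStructure.germMem_mul (hD : IsDiffStructure M D) {x : M} {f g : M → ℂ}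
    (hf : GermMem D f x) (hg : GermMem D g x) : GermMem D (fun y => f y * g y) x := by
  have := hD.germMem_comp (x := x) (g := ![f, g]) (F := fun z => z 0 * z 1)
    (by intro i; fin_cases i <;> assumption) (by fun_prop)
  simpa using this

theorem IsDiffStructure.mul_mem_s4 (hD : IsDiffStructure M D) {f g : M → ℂ}
    (hf : f ∈ D) (hg : g ∈ D) : (fun y => f y * g y) ∈ D :=
  hD.mem_of_germMem fun x => hD.germMem_mul (.of_mem hf x) (.of_mem hg x)

theorem IsDiffStructure.comp_mem (hD : IsDiffStructure M D) {f : M → ℂ}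
    (hf : f ∈ D) {F : ℂ → ℂ} (hF : ContDiff ℝ (⊤ : ℕ∞) F) : (fun y => F (f y)) ∈ D :=
  hD.comp 1 (fun _ => f) (fun _ => hf) (fun z => F (z 0)) (by fun_prop)

theorem IsDiffStructure.comp_real_mem (hD : IsDiffStructure M D) {n : ℕ} {a : M → Fin n → ℝ}
    (ha : ∀ i, (fun y => (a y i : ℂ)) ∈ D) {F : (Fin n → ℝ) → ℂ}
    (hF : ContDiff ℝ (⊤ : ℕ∞) F) : (fun y => F (a y)) ∈ D := by
  have hre : ContDiff ℝ (⊤ : ℕ∞) fun z : Fin n → ℂ => fun i => (z i).re :=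
    contDiff_pi.2 fun i => Complex.reCLM.contDiff.comp (contDiff_apply ℝ ℂ i)
  simpa using hD.comp n (fun i y => (a y i : ℂ)) ha _ (hF.comp hre)

theorem IsDiffStructure.continuous_real (hD : IsDiffStructure M D) {n : ℕ} {a : M → Fin n → ℝ}
    (ha : ∀ i, (fun y => (a y i : ℂ)) ∈ D) : Continuous a :=
  continuous_pi fun i => by
    exact Complex.continuous_re.comp (hD.continuous _ (ha i))

/-- In a locally compact differential space, neighborhoods of a point contain the support of
some structure function not vanishing at that point. -/
theorem IsDiffStructure.exists_bump_s4 [T2Space M] [LocallyCompactSpace M]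
    (hD : IsDiffStructure M D) {x : M} {W : Set M} (hW : W ∈ 𝓝 x) :
    ∃ g ∈ D, g x ≠ 0 ∧ ∀ y, g y ≠ 0 → y ∈ W := by
  obtain ⟨K, hKx, hKW, hK⟩ := local_compact_nhds hW
  have hfr : IsCompact (frontier K) := hK.of_isClosed_subset isClosed_frontier
    hK.isClosed.frontier_subset
  obtain ⟨h, hhD, hhx, hh⟩ : ∃ h ∈ D, h x = 1 ∧ ∀ᶠ z in 𝓝ˢ (frontier K), h z = 0 := by
    refine hfr.induction_on (p := fun S => ∃ h ∈ D, h x = 1 ∧ ∀ᶠ z in 𝓝ˢ S, h z = 0)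
      ⟨_, hD.const_mem_s4 1, rfl, by simp⟩ ?_ ?_ ?_
    · rintro s t hst ⟨h, h1, h2, h3⟩
      exact ⟨h, h1, h2, h3.filter_mono (nhdsSet_mono hst)⟩
    · rintro s t ⟨h, h1, h2, h3⟩ ⟨h', h1', h2', h3'⟩
      refine ⟨_, hD.mul_mem_s4 h1 h1', by simp [h2, h2'], ?_⟩
      rw [nhdsSet_union, eventually_sup]
      exact ⟨h3.mono fun z hz => by simp [hz], h3'.mono fun z hz => by simp [hz]⟩
    · intro y hy
      have hxy : y ≠ x := by
        rintro rfl
        exact hy.2 (mem_interior_iff_mem_nhds.2 hKx)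
      obtain ⟨f, hf, hne⟩ := hD.separates y x hxy
      have hpos : 0 < dist (f y) (f x) := dist_pos.2 hne
      let b : ContDiffBump (f x) :=
        { rIn := dist (f y) (f x) / 4
          rOut := dist (f y) (f x) / 2
          rIn_pos := by positivity
          rIn_lt_rOut := by linarith }
      have hopen : IsOpen {z | dist (f y) (f x) / 2 < dist (f z) (f x)} :=
        isOpen_lt continuous_const ((hD.continuous f hf).dist continuous_const)
      refine ⟨_, mem_nhdsWithin_of_mem_nhds (hopen.mem_nhds (half_lt_self hpos)),
        fun z => (b (f z) : ℂ), hD.comp_mem hf (F := fun w => (b w : ℂ))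
          (Complex.ofRealCLM.contDiff.comp b.contDiff), ?_, ?_⟩
      · have : b (f x) = 1 := b.one_of_mem_closedBall (Metric.mem_closedBall_self b.rIn_pos.le)
        simp [this]
      · rw [hopen.nhdsSet_eq]
        refine mem_principal.2 fun z hz => ?_
        have : b (f z) = 0 := b.zero_of_le_dist (le_of_lt hz)
        simp [this]
  classical
  refine ⟨fun z => if z ∈ K then h z else 0, hD.mem_of_germMem fun z => ?_, ?_, ?_⟩
  · by_cases hz : z ∈ frontier K
    · refine (GermMem.of_mem (hD.const_mem_s4 0) z).congr ?_
      filter_upwards [hh.filter_mono (nhds_le_nhdsSet hz)] with w hw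
      simp [hw]
    by_cases hzK : z ∈ K
    · have : z ∈ interior K := by
        by_contra hcon
        exact hz ⟨subset_closure hzK, hcon⟩
      refine (GermMem.of_mem hhD z).congr ?_
      filter_upwards [mem_interior_iff_mem_nhds.1 this] with w hw
      simp [hw]
    · refine (GermMem.of_mem (hD.const_mem_s4 0) z).congr ?_
      filter_upwards [hK.isClosed.isOpen_compl.mem_nhds hzK] with w hw
      simp [show w ∉ K from hw]
  · simp [mem_of_mem_nhds hKx, hhx]
  · intro y hy
    by_contra hcon
    exact hy (if_neg fun h' => hcon (hKW h'))

theorem DSmooth.continuous {E : Type*} [TopologicalSpace E] [T2Space E] [LocallyCompactSpace E]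
    {DE : Set (E → ℂ)} (hD : IsDiffStructure M D) (hDE : IsDiffStructure E DE) {s : M → E}
    (hs : DSmooth D DE s) : Continuous s := by
  refine continuous_iff_continuousAt.2 fun x W hW => ?_
  obtain ⟨g, hg, hgx, hgW⟩ := hDE.exists_bump_s4 hW
  have hc := (hD.continuous _ (hs g hg)).continuousAt (x := x)
  exact (hc.eventually_ne hgx).mono fun y hy => hgW _ hy

end Germ

/-- A frame of length `C` over an open set: a smooth family `toFun` of linear maps from `ℝ^C` to
the fibers, together with a smooth fiberwise linear right inverse `coord`. -/
structure LocalFrame {E M : Type*} [TopologicalSpace E] [TopologicalSpace M]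
    (DE : Set (E → ℂ)) (DM : Set (M → ℂ)) (π : E → M)
    (add : E → E → E) (smul : ℝ → E → E) (C : ℕ) where
  baseSet : Set M
  isOpen_baseSet : IsOpen baseSet
  toFun : (Fin C → ℝ) → M → E
  coord : E → Fin C → ℝ
  proj_toFun : ∀ v, ∀ y ∈ baseSet, π (toFun v y) = y
  toFun_add : ∀ v w, ∀ y ∈ baseSet, toFun (v + w) y = add (toFun v y) (toFun w y)
  toFun_smul : ∀ (a : ℝ) (v), ∀ y ∈ baseSet, toFun (a • v) y = smul a (toFun v y)
  toFun_coord : ∀ e, π e ∈ baseSet → toFun (coord e) (π e) = e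
  coord_add : ∀ e e', π e ∈ baseSet → π e' = π e → coord (add e e') = coord e + coord e'
  coord_smul : ∀ (a : ℝ) (e), π e ∈ baseSet → coord (smul a e) = a • coord e
  smooth_toFun : ∀ g ∈ DE, ∀ a : M → Fin C → ℝ, (∀ i, (fun y => (a y i : ℂ)) ∈ DM) →
    ∀ y ∈ baseSet, GermMem DM (fun z => g (toFun (a z) z)) y
  smooth_coord : ∀ e, π e ∈ baseSet → ∀ i, GermMem DE (fun e' => (coord e' i : ℂ)) e

/-- Extension of a vector by zero. -/
def padZero {k : ℕ} (C : ℕ) (v : Fin k → ℝ) (i : Fin C) : ℝ :=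
  if h : (i : ℕ) < k then v ⟨i, h⟩ else 0

theorem padZero_castLE {k C : ℕ} (hk : k ≤ C) (v : Fin k → ℝ) :
    padZero C v ∘ Fin.castLE hk = v := by
  ext i
  simp [padZero]

section Frame

variable {E M : Type*} [TopologicalSpace E] [TopologicalSpace M]
  {DE : Set (E → ℂ)} {DM : Set (M → ℂ)} {π : E → M}
  {add : E → E → E} {smul : ℝ → E → E}

theorem IsLocalTrivAt.exists_localFrame (hDM : IsDiffStructure M DM)
    (hDE : IsDiffStructure E DE) (hπc : Continuous π) {zero : M → E} {x : M} {k C : ℕ}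
    (hk : k ≤ C) (h : IsLocalTrivAt DE DM π add smul x k) :
    ∃ F : LocalFrame DE DM π add smul C, x ∈ F.baseSet := by
  classical
  obtain ⟨U, hUo, hxU, φ, ⟨hφ, hsm, hinv⟩, hproj, hadd, hsmul, hsurj, hinj⟩ := h
  have key : ∀ e, π e ∈ U → ∃ v : Fin k → ℝ, ∀ h : π e ∈ U, (φ (v, ⟨π e, h⟩)).val = e :=
    fun e he => (hsurj ⟨π e, he⟩ e rfl).imp fun v hv _ => hv
  choose! c hc using key
  have hc' : ∀ (v : Fin k → ℝ) (y : U), c (φ (v, y)).val = v := by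
    intro v y
    have h1 := hproj v y
    have h2 : π (φ (v, y)).val ∈ U := h1 ▸ y.2
    have h3 := hc _ h2 h2
    have h4 : (⟨π (φ (v, y)).val, h2⟩ : U) = y := Subtype.ext h1
    rw [h4] at h3
    exact hinj _ _ _ h3
  have hcφ : ∀ e (y : U), π e = y → (φ (c e, y)).val = e := by
    rintro e ⟨y, hy⟩ rfl
    exact hc e hy hy
  refine ⟨{
    baseSet := U
    isOpen_baseSet := hUo
    toFun := fun v y => if h : y ∈ U then (φ (v ∘ Fin.castLE hk, ⟨y, h⟩)).val else zero y
    coord := fun e => padZero C (c e)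
    proj_toFun := ?_
    toFun_add := ?_
    toFun_smul := ?_
    toFun_coord := ?_
    coord_add := ?_
    coord_smul := ?_
    smooth_toFun := ?_
    smooth_coord := ?_ }, hxU⟩
  · intro v y hy
    simp [hy, hproj]
  · intro v w y hy
    simp only [hy, dif_pos]
    exact hadd _ _ _
  · intro a v y hy
    simp only [hy, dif_pos]
    exact hsmul _ _ _
  · intro e he
    simp only [he, dif_pos, padZero_castLE]
    exact hc e he he
  · intro e e' he hee
    have : c (add e e') = c e + c e' := by
      conv_lhs => rw [← hcφ e ⟨π e, he⟩ rfl, ← hcφ e' ⟨π e, he⟩ hee, ← hadd, hc']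
    ext i
    simp only [this, padZero, Pi.add_apply]
    split_ifs <;> simp
  · intro a e he
    have : c (smul a e) = a • c e := by
      conv_lhs => rw [← hcφ e ⟨π e, he⟩ rfl, ← hsmul, hc']
    ext i
    simp only [this, padZero, Pi.smul_apply]
    split_ifs <;> simp
  · intro g hg a ha y hy
    have hg' : (fun e : {e : E | π e ∈ U} => g e) ∈ restrictD DE {e : E | π e ∈ U} :=
      fun e => ⟨univ, isOpen_univ, mem_univ _, g, hg, fun _ _ => rfl⟩
    obtain ⟨N, hN, n, G, hG, P, hP, hPN⟩ := hsm _ hg' (a y ∘ Fin.castLE hk, ⟨y, hy⟩)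
    have hac : Continuous a := hDM.continuous_real ha
    have hcont : Continuous fun z : U => (a z ∘ Fin.castLE hk, z) := by
      refine Continuous.prodMk (continuous_pi fun i => ?_) continuous_id
      exact (continuous_apply _).comp (hac.comp continuous_subtype_val)
    have hev : ∀ᶠ z : U in 𝓝 ⟨y, hy⟩, (a z ∘ Fin.castLE hk, z) ∈ N :=
      hcont.continuousAt hN
    have hev' : ∀ᶠ z in 𝓝 y, ∀ hz : z ∈ U, (a z ∘ Fin.castLE hk, (⟨z, hz⟩ : U)) ∈ N := by
      have := (hUo.isOpenEmbedding_subtypeVal.map_nhds_eq ⟨y, hy⟩)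
      rw [← this, eventually_map]
      filter_upwards [hev] with z hz _ using hz
    have hGm : ∀ i, ∃ q ∈ DM, ∀ᶠ z in 𝓝 y, ∀ hz : z ∈ U,
        G i (a z ∘ Fin.castLE hk, ⟨z, hz⟩) = q z := by
      intro i
      rcases hG i with ⟨f, hf, hfG⟩ | ⟨f, hf, hfG⟩
      · refine ⟨_, hDM.comp_real_mem (a := fun z => a z ∘ Fin.castLE hk)
          (fun i => ha _) hf, Eventually.of_forall fun z hz => ?_⟩
        simp [← hfG]
      · obtain ⟨V, hV, hyV, q, hq, hqV⟩ := hf ⟨y, hy⟩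
        refine ⟨q, hq, ?_⟩
        filter_upwards [hV.mem_nhds hyV] with z hz hzU
        simp [← hfG, hqV ⟨z, hzU⟩ hz]
    choose q hq hqG using hGm
    refine ⟨_, hDM.comp n q hq P hP, ?_⟩
    filter_upwards [hUo.mem_nhds hy, hev', eventually_all.2 hqG] with z hz hzN hzG
    have := hPN _ (hzN hz)
    simp only [Function.comp_apply] at this
    simp only [hz, dif_pos, this, hzG _ hz]
  · intro e he i
    by_cases hi : (i : ℕ) < k
    · have hmem : (fun p : (Fin k → ℝ) × U => (p.1 ⟨i, hi⟩ : ℂ)) ∈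
          prodD (euclD k) (restrictD DM U) := by
        refine fun p => ⟨univ, univ_mem, 1,
          fun _ => (fun v : Fin k → ℝ => (v ⟨i, hi⟩ : ℂ)) ∘ Prod.fst,
          fun _ => Or.inl ⟨_, ?_, rfl⟩, fun z => z 0, by fun_prop, fun _ _ => rfl⟩
        change ContDiff ℝ (⊤ : ℕ∞) _
        exact Complex.ofRealCLM.contDiff.comp (contDiff_apply ℝ ℝ (⟨i, hi⟩ : Fin k))
      obtain ⟨h, hh, hhφ⟩ := hinv _ hmem
      obtain ⟨V, hV, heV, g, hg, hgV⟩ := hh ⟨e, he⟩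
      refine ⟨g, hg, ?_⟩
      filter_upwards [hV.mem_nhds heV, (hUo.preimage hπc).mem_nhds he] with e' he' heU
      have h1 := hhφ (c e', ⟨π e', heU⟩)
      have h2 : φ (c e', ⟨π e', heU⟩) = ⟨e', heU⟩ := Subtype.ext (hc e' heU heU)
      rw [h2, hgV ⟨e', heU⟩ he'] at h1
      simp [padZero, hi, h1]
    · refine (GermMem.of_mem (hDE.const_mem_s4 0) e).congr (Eventually.of_forall fun e' => ?_)
      simp [padZero, hi]

theorem LocalFrame.coord_foldr {C : ℕ} (F : LocalFrame DE DM π add smul C) {zero : M → E}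
    (hπzero : ∀ x, π (zero x) = x) (hπadd : ∀ e e', π e = π e' → π (add e e') = π e)
    (hzero_smul : ∀ e, smul 0 e = zero (π e)) {x : M} (hx : x ∈ F.baseSet) (l : List E)
    (hl : ∀ e ∈ l, π e = x) :
    π (l.foldr add (zero x)) = x ∧ F.coord (l.foldr add (zero x)) = (l.map F.coord).sum := by
  induction l with
  | nil =>
    refine ⟨hπzero x, ?_⟩
    have := F.coord_smul 0 (zero x) (by rwa [hπzero])
    rw [hzero_smul, hπzero] at this
    simpa using this
  | cons e l ih =>
    obtain ⟨h1, h2⟩ := ih fun e' he' => hl e' (List.mem_cons_of_mem _ he')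
    have he : π e = x := hl e List.mem_cons_self
    refine ⟨?_, ?_⟩
    · rw [List.foldr_cons, hπadd _ _ (he.trans h1.symm), he]
    · rw [List.foldr_cons, F.coord_add _ _ (by rwa [he]) (h1.trans he.symm), h2]
      simp

theorem LocalFrame.eq_of_coord_eq {C : ℕ} (F : LocalFrame DE DM π add smul C) {e e' : E}
    (he : π e ∈ F.baseSet) (hee : π e' = π e) (h : F.coord e = F.coord e') : e = e' := by
  rw [← F.toFun_coord e he, ← F.toFun_coord e' (hee ▸ he), h, hee]

/-- The coordinate change from one frame to another over a common point. -/
def LocalFrame.coordChange {C : ℕ} (F G : LocalFrame DE DM π add smul C) (x : M)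
    (hF : x ∈ F.baseSet) (hG : x ∈ G.baseSet) : (Fin C → ℝ) →ₗ[ℝ] Fin C → ℝ where
  toFun v := G.coord (F.toFun v x)
  map_add' v w := by
    rw [F.toFun_add v w x hF, G.coord_add]
    · rwa [F.proj_toFun v x hF]
    · rw [F.proj_toFun v x hF, F.proj_toFun w x hF]
  map_smul' a v := by
    rw [F.toFun_smul a v x hF, G.coord_smul]
    · rfl
    · rwa [F.proj_toFun v x hF]

theorem LocalFrame.sum_coord_smul {C : ℕ} (F G : LocalFrame DE DM π add smul C) {e : E}
    (hF : π e ∈ F.baseSet) (hG : π e ∈ G.baseSet) :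
    ∑ i, F.coord e i • G.coord (F.toFun (Pi.single i 1) (π e)) = G.coord e := by
  let L := F.coordChange G (π e) hF hG
  calc ∑ i, F.coord e i • L (Pi.single i 1) = L (F.coord e) := by
        conv_rhs => rw [pi_eq_sum_univ' (F.coord e)]
        simp only [map_sum, map_smul]
    _ = G.coord e := by
        change G.coord (F.toFun (F.coord e) (π e)) = _
        rw [F.toFun_coord e hF]

end Frame

section Covering

variable {M : Type*} [TopologicalSpace M] {DM : Set (M → ℂ)}

theorem IsClosedSmoothEmbedding.comp_mem {n : ℕ} {φ : M → Fin n → ℝ}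
    (hφ : IsClosedSmoothEmbedding DM (euclD n) φ) {f : (Fin n → ℝ) → ℝ}
    (hf : ContDiff ℝ (⊤ : ℕ∞) f) : (fun x => (f (φ x) : ℂ)) ∈ DM :=
  hφ.2.1 (fun y => (f y : ℂ)) fun _ => ⟨univ, isOpen_univ, mem_univ _, _,
    Complex.ofRealCLM.contDiff.comp hf, fun _ _ => rfl⟩

/-- Every neighborhood assignment on a finite-dimensional differential space has an open
refinement by finitely many pairwise disjoint families; the unions of these families carry a
subordinate partition of unity `ρ` and cutoff functions `θ` equal to `1` where `ρ` is nonzero. -/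
theorem IsClosedSmoothEmbedding.exists_disjoint_families {n : ℕ} {φ : M → Fin n → ℝ}
    (hφ : IsClosedSmoothEmbedding DM (euclD n) φ) {U : M → Set M} (hU : ∀ x, U x ∈ 𝓝 x) :
    ∃ (N : ℕ) (s : Fin N → Set M) (B : M → Set M) (ρ θ : Fin N → M → ℝ),
      (∀ j, IsOpen (B j) ∧ B j ⊆ U j) ∧ (∀ c, (s c).PairwiseDisjoint B) ∧
      (∀ c, (fun x => (ρ c x : ℂ)) ∈ DM) ∧ (∀ c, (fun x => (θ c x : ℂ)) ∈ DM) ∧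
      (∀ c x, ρ c x ≠ 0 → θ c x = 1) ∧
      (∀ c x, (¬ ∃ j ∈ s c, x ∈ B j) → ∀ᶠ y in 𝓝 x, θ c y = 0) ∧
      ∀ x, ∑ c, ρ c x = 1 := by
  have hr : ∀ x, ∃ r : ℝ, 0 < r ∧ r ≤ 1 ∧ φ ⁻¹' Metric.ball (φ x) r ⊆ U x := by
    intro x
    have := hU x
    rw [hφ.1.isInducing.nhds_eq_comap, mem_comap] at this
    obtain ⟨t, ht, htU⟩ := this
    obtain ⟨r, hr, hrt⟩ := Metric.mem_nhds_iff.1 ht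
    exact ⟨min r 1, lt_min hr one_pos, min_le_right _ _,
      (preimage_mono ((Metric.ball_subset_ball (min_le_left _ _)).trans hrt)).trans htU⟩
  choose r hr0 hr1 hrU using hr
  obtain ⟨N, τ, hτ, hN⟩ :=
    HasBesicovitchCovering.no_satelliteConfig (α := Fin n → ℝ)
  obtain ⟨s, hs, hcov⟩ := Besicovitch.exist_disjoint_covering_families hτ hN
    (⟨φ, r, hr0, 1, hr1⟩ : Besicovitch.BallPackage M (Fin n → ℝ))
  dsimp only at hs hcov
  let W : Fin N → Set (Fin n → ℝ) := fun c => ⋃ j ∈ s c, Metric.ball (φ j) (r j)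
  have hW : ∀ c, IsOpen (W c) := fun c =>
    isOpen_biUnion fun _ _ => Metric.isOpen_ball
  obtain ⟨ρ, hρ⟩ := SmoothPartitionOfUnity.exists_isSubordinate (modelWithCornersSelf ℝ (Fin n → ℝ))
    hφ.1.isClosed_range W hW hcov
  have hθ := fun c => exists_contMDiffMap_zero_one_nhds_of_isClosed
    (n := (⊤ : ℕ∞)) (modelWithCornersSelf ℝ (Fin n → ℝ)) (hW c).isClosed_compl
    (isClosed_tsupport (ρ c)) (disjoint_compl_left_iff_subset.2 (hρ c))
  choose θ hθ0 hθ1 _ using hθ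
  refine ⟨N, s, fun j => φ ⁻¹' Metric.ball (φ j) (r j), fun c x => ρ c (φ x),
    fun c x => θ c (φ x), fun j => ⟨Metric.isOpen_ball.preimage hφ.1.continuous, hrU j⟩,
    ?_, fun c => hφ.comp_mem (ρ c).contMDiff.contDiff,
    fun c => hφ.comp_mem (θ c).contMDiff.contDiff, ?_, ?_, ?_⟩
  · intro c i hi j hj hij
    exact ((hs c hi hj hij).mono Metric.ball_subset_closedBall
      Metric.ball_subset_closedBall).preimage φ
  · intro c x hx
    exact (hθ1 c).self_of_nhdsSet _ (subset_tsupport _ hx)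
  · intro c x hx
    have hx' : φ x ∈ (W c)ᶜ := by simpa [W] using hx
    exact hφ.1.continuous.continuousAt ((hθ0 c).filter_mono (nhds_le_nhdsSet hx'))
  · intro x
    have := ρ.sum_eq_one (mem_range_self x)
    rwa [finsum_eq_sum_of_fintype] at this

end Covering

/-- A real vector bundle over a finite-dimensional differential space, with fibers of uniformly
bounded dimension, has a finitely generated `C^∞(M,ℝ)`-module of smooth sections. -/
theorem stmt_4
    {M : Type*} [TopologicalSpace M] [T2Space M] [LocallyCompactSpace M]
    [SecondCountableTopology M]
    {E : Type*} [TopologicalSpace E] [T2Space E] [LocallyCompactSpace E]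
    [SecondCountableTopology E]
    (DM : Set (M → ℂ)) (DE : Set (E → ℂ))
    (hDM : IsDiffStructure M DM) (hDE : IsDiffStructure E DE)
    -- `M` is a finite-dimensional differential space
    (hMfd : ∃ (n : ℕ) (φ : M → (Fin n → ℝ)), IsClosedSmoothEmbedding DM (euclD n) φ)
    -- bundle data: smooth projection with fiberwise vector space operations
    (π : E → M) (hπ : DSmooth DE DM π)
    (add : E → E → E) (smul : ℝ → E → E) (zero : M → E)
    (hπzero : ∀ x, π (zero x) = x)
    (hπadd : ∀ e e', π e = π e' → π (add e e') = π e)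
    (hπsmul : ∀ a e, π (smul a e) = π e)
    (hcomm : ∀ e e', π e = π e' → add e e' = add e' e)
    (hassoc : ∀ e e' e'', π e = π e' → π e' = π e'' →
      add (add e e') e'' = add e (add e' e''))
    (hzero_add : ∀ e, add (zero (π e)) e = e)
    (hone_smul : ∀ e, smul 1 e = e)
    (hmul_smul : ∀ a b e, smul a (smul b e) = smul (a * b) e)
    (hsmul_add : ∀ a e e', π e = π e' → smul a (add e e') = add (smul a e) (smul a e'))
    (hadd_smul : ∀ a b e, smul (a + b) e = add (smul a e) (smul b e))
    (hzero_smul : ∀ e, smul 0 e = zero (π e))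
    -- local triviality with uniformly bounded rank (`x ↦ dim E_x` is bounded)
    (htriv : ∃ C : ℕ, ∀ x : M, ∃ k ≤ C, IsLocalTrivAt DE DM π add smul x k) :
    ∃ (m : ℕ) (σ : Fin m → M → E),
      (∀ i, DSmooth DM DE (σ i) ∧ ∀ x, π (σ i x) = x) ∧
      ∀ s : M → E, (DSmooth DM DE s ∧ ∀ x, π (s x) = x) →
        ∃ f : Fin m → M → ℝ, (∀ i, (fun x => (f i x : ℂ)) ∈ DM) ∧
          ∀ x, s x = (List.ofFn fun i => smul (f i x) (σ i x)).foldr add (zero x) := by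
  classical
  obtain ⟨n, φ, hφ⟩ := hMfd
  obtain ⟨C, hC⟩ := htriv
  have hF : ∀ x, ∃ F : LocalFrame DE DM π add smul C, x ∈ F.baseSet := fun x => by
    obtain ⟨k, hk, h⟩ := hC x
    exact h.exists_localFrame hDM hDE (hπ.continuous hDE hDM) (zero := zero) hk
  choose F hxF using hF
  obtain ⟨N, S, B, ρ, θ, hB, hdisj, hρ, hθ, hρθ, hθ0, hsum⟩ := hφ.exists_disjoint_families
    fun x => (F x).isOpen_baseSet.mem_nhds (hxF x)
  have hJ : ∀ c y, ∃ j, (∃ j ∈ S c, y ∈ B j) → j ∈ S c ∧ y ∈ B j := by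
    intro c y
    by_cases h : ∃ j ∈ S c, y ∈ B j
    · exact h.imp fun j hj _ => hj
    · exact ⟨y, fun h' => absurd h' h⟩
  choose J hJ using hJ
  have hJeq : ∀ c y j, j ∈ S c → y ∈ B j → J c y = j := by
    intro c y j hj hy
    obtain ⟨h1, h2⟩ := hJ c y ⟨j, hj, hy⟩
    by_contra hne
    exact Set.disjoint_left.1 (hdisj c h1 hj hne) h2 hy
  have hzero_toFun : ∀ x, ∀ y ∈ (F x).baseSet, (F x).toFun 0 y = zero y := by
    intro x y hy
    have := (F x).toFun_smul 0 0 y hy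
    rwa [zero_smul, hzero_smul, (F x).proj_toFun _ _ hy] at this
  let τ : Fin N → Fin C → M → E := fun c i y =>
    if ∃ j ∈ S c, y ∈ B j then (F (J c y)).toFun (θ c y • Pi.single i 1) y else zero y
  have hτπ : ∀ c i y, π (τ c i y) = y := by
    intro c i y
    by_cases h : ∃ j ∈ S c, y ∈ B j
    · simp only [τ, if_pos h]
      exact (F _).proj_toFun _ _ ((hB _).2 (hJ c y h).2)
    · simp only [τ, if_neg h, hπzero]
  have hτs : ∀ c i, DSmooth DM DE (τ c i) := by
    intro c i g hg
    refine hDM.mem_of_germMem fun x => ?_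
    by_cases h : ∃ j ∈ S c, x ∈ B j
    · obtain ⟨j, hj, hx⟩ := h
      refine ((F j).smooth_toFun g hg (fun y => θ c y • Pi.single i 1) (fun l => ?_) x
        ((hB j).2 hx)).congr ?_
      · simpa using hDM.mul_mem_s4 (hθ c) (hDM.const_mem_s4 ((Pi.single i 1 : Fin C → ℝ) l : ℝ))
      · filter_upwards [(hB j).1.mem_nhds hx] with y hy
        simp only [Function.comp_apply, τ, if_pos (⟨j, hj, hy⟩ : ∃ j ∈ S c, y ∈ B j),
          hJeq c y j hj hy]
    · refine ((F x).smooth_toFun g hg (fun _ => 0) (fun l => ?_) x (hxF x)).congr ?_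
      · simpa using hDM.const_mem_s4 0
      · filter_upwards [hθ0 c x h, (F x).isOpen_baseSet.mem_nhds (hxF x)] with y hy hyx
        rw [hzero_toFun x y hyx, Function.comp_apply]
        by_cases h' : ∃ j ∈ S c, y ∈ B j
        · simp only [τ, if_pos h', hy, zero_smul]
          rw [hzero_toFun _ _ ((hB _).2 (hJ c y h').2)]
        · simp only [τ, if_neg h']
  refine ⟨N * C, fun m => τ (finProdFinEquiv.symm m).1 (finProdFinEquiv.symm m).2,
    fun m => ⟨hτs _ _, hτπ _ _⟩, ?_⟩
  rintro s ⟨hs, hsπ⟩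
  have hsc : Continuous s := hs.continuous hDM hDE
  let f : Fin N → Fin C → M → ℝ := fun c i y =>
    if ∃ j ∈ S c, y ∈ B j then ρ c y * (F (J c y)).coord (s y) i else 0
  have hf : ∀ c i, (fun y => (f c i y : ℂ)) ∈ DM := by
    intro c i
    refine hDM.mem_of_germMem fun x => ?_
    by_cases h : ∃ j ∈ S c, x ∈ B j
    · obtain ⟨j, hj, hx⟩ := h
      obtain ⟨g, hg, hgs⟩ := (F j).smooth_coord (s x) (by rw [hsπ]; exact (hB j).2 hx) i
      refine (hDM.germMem_mul (.of_mem (hρ c) x) (.of_mem (hs g hg) x)).congr ?_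
      filter_upwards [(hB j).1.mem_nhds hx, hsc.continuousAt.eventually hgs] with y hy hgy
      simp only [f, if_pos (⟨j, hj, hy⟩ : ∃ j ∈ S c, y ∈ B j), hJeq c y j hj hy,
        Complex.ofReal_mul, hgy, Function.comp_apply]
    · refine (GermMem.of_mem (hDM.const_mem_s4 0) x).congr ?_
      filter_upwards [hθ0 c x h] with y hy
      have : ρ c y = 0 := by
        by_contra hne
        exact one_ne_zero ((hρθ c y hne).symm.trans hy)
      simp [f, this]
  refine ⟨fun m => f (finProdFinEquiv.symm m).1 (finProdFinEquiv.symm m).2,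
    fun m => hf _ _, fun x => ?_⟩
  obtain ⟨hπl, hcl⟩ := (F x).coord_foldr hπzero hπadd hzero_smul (hxF x)
    (List.ofFn fun m : Fin (N * C) => smul (f (finProdFinEquiv.symm m).1 (finProdFinEquiv.symm m).2 x)
      (τ (finProdFinEquiv.symm m).1 (finProdFinEquiv.symm m).2 x))
    (by
      intro e he
      obtain ⟨m, rfl⟩ := (List.mem_ofFn' _ _).1 he
      rw [hπsmul, hτπ])
  refine (F x).eq_of_coord_eq (by rw [hsπ]; exact hxF x) (hπl.trans (hsπ x).symm) ?_
  rw [hcl, List.map_ofFn, List.sum_ofFn]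
  simp only [Function.comp_apply]
  rw [finProdFinEquiv.symm.sum_comp
    (fun p : Fin N × Fin C => (F x).coord (smul (f p.1 p.2 x) (τ p.1 p.2 x))),
    Fintype.sum_prod_type]
  have hcolor : ∀ c, ∑ i, (F x).coord (smul (f c i x) (τ c i x)) = ρ c x • (F x).coord (s x) := by
    intro c
    have hco : ∀ i, (F x).coord (smul (f c i x) (τ c i x)) = f c i x • (F x).coord (τ c i x) :=
      fun i => (F x).coord_smul _ _ (by rw [hτπ]; exact hxF x)
    simp only [hco]
    by_cases hρ0 : ρ c x = 0
    · simp [f, hρ0]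
    have hθ1 := hρθ c x hρ0
    have h : ∃ j ∈ S c, x ∈ B j := by
      by_contra h
      exact one_ne_zero (hθ1.symm.trans (hθ0 c x h).self_of_nhds)
    have hbase : x ∈ (F (J c x)).baseSet := (hB _).2 (hJ c x h).2
    have := (F (J c x)).sum_coord_smul (F x) (e := s x) (by rwa [hsπ]) (by rw [hsπ]; exact hxF x)
    rw [← this, hsπ, Finset.smul_sum]
    simp only [f, τ, if_pos h, hθ1, one_smul, smul_smul]
  simp only [hcolor, ← Finset.sum_smul, hsum, one_smul]
end

section
/- Let N ∈ ℕ with N ≥ 2, b ∈ ℝ with b ≠ 0, and c ∈ ℂ. Let L be the differential operator on smooth functions ℝ → ℂ given by (Lf)(t) = f''(t) − b²·t^{2(N−1)}·f(t). If u : ℝ → ℂ is infinitely differentiable, square-integrable on ℝ, and satisfies L^N u = c·u pointwise on ℝ (L^N denoting the N-fold iterate of L), then u is a Schwartz function: for all p, q ∈ ℤ≥0, sup_{t∈ℝ} |t^p·u^{(q)}(t)| < ∞. -/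
/-- The differential operator `(L f)(t) = f''(t) − b²·t^{2(N−1)}·f(t)` on functions `ℝ → ℂ`. -/
noncomputable def Lop (N : ℕ) (b : ℝ) (f : ℝ → ℂ) : ℝ → ℂ :=
  fun t => deriv (deriv f) t - ((b ^ 2 * t ^ (2 * (N - 1)) : ℝ) : ℂ) * f t

open MeasureTheory

section WeightedIdentities

variable {E : Type*} [NormedAddCommGroup E] [InnerProductSpace ℝ E]

/-- A continuous function vanishing wherever a compactly supported function vanishes is
integrable. -/
lemma integrable_of_support_le {η F : ℝ → ℝ} (hη : HasCompactSupport η) (hF : Continuous F)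
    (h : ∀ t, η t = 0 → F t = 0) : Integrable F :=
  hF.integrable_of_hasCompactSupport (hη.mono fun t ht h0 => ht (h t h0))

/-- The integrand of the integration by parts of `⟪f, v⟫` against the weight `η²`. -/
noncomputable def partsIntegrand (η : ℝ → ℝ) (f v : ℝ → E) (t : ℝ) : ℝ :=
  2 * η t * deriv η t * inner ℝ (f t) (v t) +
    η t ^ 2 * (inner ℝ (f t) (deriv v t) + inner ℝ (deriv f t) (v t))

lemma integrable_partsIntegrand {η : ℝ → ℝ} {f v : ℝ → E} (hη : ContDiff ℝ 1 η)
    (hc : HasCompactSupport η) (hf : ContDiff ℝ 1 f) (hv : ContDiff ℝ 1 v) :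
    Integrable (partsIntegrand η f v) := by
  have h1 := hη.continuous
  have h2 := hη.continuous_deriv le_rfl
  have h3 := hf.continuous
  have h4 := hf.continuous_deriv le_rfl
  have h5 := hv.continuous
  have h6 := hv.continuous_deriv le_rfl
  refine integrable_of_support_le hc ?_ fun t ht => by simp [partsIntegrand, ht]
  unfold partsIntegrand
  fun_prop

lemma integral_partsIntegrand {η : ℝ → ℝ} {f v : ℝ → E} (hη : ContDiff ℝ 1 η)
    (hc : HasCompactSupport η) (hf : ContDiff ℝ 1 f) (hv : ContDiff ℝ 1 v) :
    ∫ t, partsIntegrand η f v t = 0 := by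
  have h1 := hη.continuous
  have h3 := hf.continuous
  have h5 := hv.continuous
  refine integral_eq_zero_of_hasDerivAt_of_integrable
    (f := fun t => η t ^ 2 * inner ℝ (f t) (v t)) (fun t => ?_)
    (integrable_partsIntegrand hη hc hf hv)
    (integrable_of_support_le hc (by fun_prop) fun t ht => by simp [ht])
  have a := (hη.differentiable one_ne_zero t).hasDerivAt
  have b := (hf.differentiable one_ne_zero t).hasDerivAt
  have c := (hv.differentiable one_ne_zero t).hasDerivAt
  refine ((a.pow 2).mul (b.inner ℝ c)).congr_deriv ?_
  simp [partsIntegrand]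

/-- Weighted energy estimate for `w'' = V w + h`. -/
lemma integral_energy_le {η V B : ℝ → ℝ} {w h : ℝ → E} (hη : ContDiff ℝ 1 η)
    (hc : HasCompactSupport η) (hV : Continuous V) (hw : ContDiff ℝ 2 w)
    (heq : ∀ t, deriv (deriv w) t = V t • w t + h t) (hB : Integrable B)
    (hle : ∀ t, 2 * η t ^ 2 * (‖h t‖ * ‖w t‖) + 4 * deriv η t ^ 2 * ‖w t‖ ^ 2 ≤ B t)
    (hV0 : ∀ t, 0 ≤ V t) :
    ∫ t, η t ^ 2 * (‖deriv w t‖ ^ 2 + V t * ‖w t‖ ^ 2) ≤ ∫ t, B t := by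
  have hw' : ContDiff ℝ 1 (deriv w) := hw.deriv'
  have hw1 : ContDiff ℝ 1 w := hw.of_le (by norm_num)
  have hI := integrable_partsIntegrand hη hc hw' hw1
  have h0 := integral_partsIntegrand hη hc hw' hw1
  have h1 := hη.continuous
  have h3 := hw1.continuous
  have h5 := hw'.continuous
  calc _ ≤ ∫ t, (2 * partsIntegrand η (deriv w) w t + B t) := by
        refine integral_mono (integrable_of_support_le hc (by fun_prop) fun t ht => by simp [ht])
          ((hI.const_mul 2).add hB) fun t => ?_
        refine le_trans ?_ (add_le_add_right (hle t) _)
        simp only [partsIntegrand, heq, inner_add_left, inner_smul_left, real_inner_self_eq_norm_sq,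
          RCLike.conj_to_real]
        have e1 : -(‖h t‖ * ‖w t‖) ≤ inner ℝ (h t) (w t) :=
          (abs_le.1 (abs_real_inner_le_norm _ _)).1
        have e2 : |η t * deriv η t * inner ℝ (deriv w t) (w t)| ≤
            |η t * deriv η t| * (‖deriv w t‖ * ‖w t‖) := by
          rw [abs_mul]
          exact mul_le_mul_of_nonneg_left (abs_real_inner_le_norm _ _) (abs_nonneg _)
        have e3 := (abs_le.1 e2).1
        have e4 := mul_le_mul_of_nonneg_left e1 (sq_nonneg (η t))
        have e5 := sq_nonneg (|η t| * ‖deriv w t‖ - 2 * |deriv η t| * ‖w t‖)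
        rw [abs_mul] at e3
        have e6 := sq_abs (η t)
        have e7 := sq_abs (deriv η t)
        have e8 : 0 ≤ η t ^ 2 * (V t * ‖w t‖ ^ 2) :=
          mul_nonneg (sq_nonneg _) (mul_nonneg (hV0 t) (sq_nonneg _))
        have e9 : (|η t| * ‖deriv w t‖ - 2 * |deriv η t| * ‖w t‖) ^ 2 =
          η t ^ 2 * ‖deriv w t‖ ^ 2 - 4 * (|η t| * |deriv η t| * (‖deriv w t‖ * ‖w t‖))
            + 4 * deriv η t ^ 2 * ‖w t‖ ^ 2 := by rw [← e6, ← e7]; ring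
        linarith
    _ = _ := by
        rw [integral_add (hI.const_mul 2) hB, integral_const_mul, h0]; ring

/-- Weighted estimate of `h = w'' - V w` by the energies of `w` and `h`. -/
lemma integral_source_le {η V B : ℝ → ℝ} {w h : ℝ → E} (hη : ContDiff ℝ 1 η)
    (hc : HasCompactSupport η) (hw : ContDiff ℝ 2 w)
    (hh : ContDiff ℝ 1 h) (heq : ∀ t, deriv (deriv w) t = V t • w t + h t) (hB : Integrable B)
    (hle : ∀ t, 2 * η t ^ 2 * (‖deriv w t‖ * ‖deriv h t‖ + V t * (‖w t‖ * ‖h t‖)) +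
      4 * deriv η t ^ 2 * ‖deriv w t‖ ^ 2 ≤ B t) (hV0 : ∀ t, 0 ≤ V t) :
    ∫ t, η t ^ 2 * ‖h t‖ ^ 2 ≤ ∫ t, B t := by
  have hw' : ContDiff ℝ 1 (deriv w) := hw.deriv'
  have hI := integrable_partsIntegrand hη hc hw' hh
  have h0 := integral_partsIntegrand hη hc hw' hh
  have h1 := hη.continuous
  have h3 := hh.continuous
  calc _ ≤ ∫ t, (2 * partsIntegrand η (deriv w) h t + B t) := by
        refine integral_mono (integrable_of_support_le hc (by fun_prop) fun t ht => by simp [ht])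
          ((hI.const_mul 2).add hB) fun t => ?_
        refine le_trans ?_ (add_le_add_right (hle t) _)
        simp only [partsIntegrand, heq, inner_add_left, inner_smul_left, real_inner_self_eq_norm_sq,
          RCLike.conj_to_real]
        have e1 : -(‖deriv w t‖ * ‖deriv h t‖) ≤ inner ℝ (deriv w t) (deriv h t) :=
          (abs_le.1 (abs_real_inner_le_norm _ _)).1
        have e1' : -(‖w t‖ * ‖h t‖) ≤ inner ℝ (w t) (h t) :=
          (abs_le.1 (abs_real_inner_le_norm _ _)).1
        have e2 : |η t * deriv η t * inner ℝ (deriv w t) (h t)| ≤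
            |η t * deriv η t| * (‖deriv w t‖ * ‖h t‖) := by
          rw [abs_mul]
          exact mul_le_mul_of_nonneg_left (abs_real_inner_le_norm _ _) (abs_nonneg _)
        have e3 := (abs_le.1 e2).1
        have e4 := mul_le_mul_of_nonneg_left e1 (sq_nonneg (η t))
        have e4' := mul_le_mul_of_nonneg_left (mul_le_mul_of_nonneg_left e1' (hV0 t))
          (sq_nonneg (η t))
        have e5 := sq_nonneg (|η t| * ‖h t‖ - 2 * |deriv η t| * ‖deriv w t‖)
        rw [abs_mul] at e3
        have e6 := sq_abs (η t)
        have e7 := sq_abs (deriv η t)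
        have e9 : (|η t| * ‖h t‖ - 2 * |deriv η t| * ‖deriv w t‖) ^ 2 =
          η t ^ 2 * ‖h t‖ ^ 2 - 4 * (|η t| * |deriv η t| * (‖deriv w t‖ * ‖h t‖))
            + 4 * deriv η t ^ 2 * ‖deriv w t‖ ^ 2 := by rw [← e6, ← e7]; ring
        linarith
    _ = _ := by
        rw [integral_add (hI.const_mul 2) hB, integral_const_mul, h0]; ring

end WeightedIdentities

/-- If each term of a family of real sequences is interpolated between its neighbours,
uniformly over the family, then each term is interpolated between its successor and the zeroth
term. -/
lemma exists_interpolation {ι : Type*} {Y : ι → ℕ → ℝ} {K : ℕ → ℝ}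
    (hK : ∀ j, 0 ≤ K j)
    (h : ∀ i j, ∀ ε > 0, Y i (j + 1) ≤ ε * Y i (j + 2) + (ε⁻¹ + K j) * Y i j) (j : ℕ) :
    ∀ ε > 0, ∃ C, ∀ i, Y i (j + 1) ≤ ε * Y i (j + 2) + C * Y i 0 := by
  induction j with
  | zero => exact fun ε hε => ⟨_, fun i => h i 0 ε hε⟩
  | succ j ih =>
    intro ε hε
    set D : ℝ := (ε / 2)⁻¹ + K (j + 1) with hD
    have hDpos : 0 < D := add_pos_of_pos_of_nonneg (by positivity) (hK _)
    obtain ⟨C, hC⟩ := ih (1 / (2 * D)) (by positivity)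
    refine ⟨2 * D * C, fun i => ?_⟩
    have h1 := h i (j + 1) (ε / 2) (by positivity)
    have h2 := mul_le_mul_of_nonneg_left (hC i) hDpos.le
    have h3 : D * (1 / (2 * D) * Y i (j + 2) + C * Y i 0) = Y i (j + 2) / 2 + D * C * Y i 0 := by
      field_simp
    have h4 : j + 1 + 1 = j + 2 := rfl
    have h5 : j + 1 + 2 = j + 3 := rfl
    rw [h4, h5] at *
    linarith

/-- In the situation of `exists_interpolation`, a bound on one term by the zeroth one gives such
bounds for all preceding terms. -/
lemma exists_bound_of_interpolation {ι : Type*} {Y : ι → ℕ → ℝ} {K : ℕ → ℝ}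
    (hK : ∀ j, 0 ≤ K j)
    (h : ∀ i j, ∀ ε > 0, Y i (j + 1) ≤ ε * Y i (j + 2) + (ε⁻¹ + K j) * Y i j)
    {M : ℕ} {D : ℝ} (hM : ∀ i, Y i M ≤ D * Y i 0) {j : ℕ} (hj : j ≤ M) :
    ∃ C, ∀ i, Y i j ≤ C * Y i 0 := by
  induction hj using Nat.decreasingInduction with
  | self => exact ⟨D, hM⟩
  | of_succ k hk ih =>
    obtain ⟨C, hC⟩ := ih
    cases k with
    | zero => exact ⟨1, fun i => by simp⟩
    | succ k =>
      obtain ⟨C', hC'⟩ := exists_interpolation hK h k 1 one_pos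
      exact ⟨C + C', fun i => by
        have h1 := hC i
        have h2 := hC' i
        have h4 : k + 1 + 1 = k + 2 := rfl
        rw [h4] at h1
        linarith⟩

/-- Smooth cutoffs equal to `1` on `[-R, R]`, with derivatives bounded independently of `R`. -/
lemma exists_cutoff : ∃ C : ℝ, ∀ R : ℝ, 1 ≤ R → ∃ χ : ℝ → ℝ, ContDiff ℝ 1 χ ∧
    HasCompactSupport χ ∧ (∀ t, 0 ≤ χ t) ∧ (∀ t, χ t ≤ 1) ∧ (∀ t, |t| ≤ R → χ t = 1) ∧
    ∀ t, |deriv χ t| ≤ C := by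
  let f : ContDiffBump (0 : ℝ) := ⟨1, 2, one_pos, one_lt_two⟩
  have hf : ContDiff ℝ 1 f := f.contDiff (n := 1)
  obtain ⟨C, hC⟩ := (hf.continuous_deriv le_rfl).bounded_above_of_compact_support
    f.hasCompactSupport.deriv
  have hC0 : 0 ≤ C := (norm_nonneg _).trans (hC 0)
  refine ⟨C, fun R hR => ⟨fun t => f (R⁻¹ * t), ?_, ?_, fun t => f.nonneg, fun t => f.le_one,
    fun t ht => ?_, fun t => ?_⟩⟩
  · fun_prop
  · exact f.hasCompactSupport.comp_homeomorph (Homeomorph.mulLeft₀ R⁻¹ (by positivity))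
  · apply f.one_of_mem_closedBall
    have hR0 : 0 < R := by linarith
    simp only [f, Metric.mem_closedBall, dist_zero_right, norm_mul, Real.norm_eq_abs, abs_inv,
      abs_of_pos hR0]
    rwa [inv_mul_le_iff₀ hR0, mul_one]
  · rw [deriv_comp_mul_left, smul_eq_mul, abs_mul]
    have h1 : |R⁻¹| ≤ 1 := by
      rw [abs_of_nonneg (by positivity)]
      exact inv_le_one_of_one_le₀ hR
    calc |R⁻¹| * |deriv f (R⁻¹ * t)| ≤ 1 * C := by
          gcongr
          exact hC _
      _ = C := one_mul C

/-- A nonnegative continuous function whose integrals against cutoffs are bounded is integrable. -/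
lemma integrable_of_cutoff {F : ℝ → ℝ} (hF : Continuous F) (hF0 : ∀ t, 0 ≤ F t) {B : ℝ}
    (h : ∀ R : ℝ, 1 ≤ R → ∃ χ : ℝ → ℝ, (∀ t, 0 ≤ χ t) ∧ (∀ t, |t| ≤ R → χ t = 1) ∧
      Integrable (fun t => χ t * F t) ∧ ∫ t, χ t * F t ≤ B) : Integrable F := by
  refine integrable_of_intervalIntegral_norm_bounded (l := Filter.atTop) (a := fun R : ℝ => -R)
    (b := fun R : ℝ => R) B (fun R => hF.integrableOn_Ioc) Filter.tendsto_neg_atTop_atBot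
    Filter.tendsto_id ?_
  filter_upwards [Filter.eventually_ge_atTop 1] with R hR
  obtain ⟨χ, h0, h1, hi, hB⟩ := h R hR
  refine le_trans ?_ hB
  rw [intervalIntegral.integral_of_le (by linarith)]
  calc ∫ t in Set.Ioc (-R) R, ‖F t‖ = ∫ t in Set.Ioc (-R) R, χ t * F t := by
        refine setIntegral_congr_fun measurableSet_Ioc fun t ht => ?_
        simp [h1 t (abs_le.2 ⟨ht.1.le, ht.2⟩), abs_of_nonneg (hF0 t)]
    _ ≤ ∫ t, χ t * F t :=
        setIntegral_le_integral hi (Filter.Eventually.of_forall fun t => mul_nonneg (h0 t) (hF0 t))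

section Chain

variable {E : Type*} [NormedAddCommGroup E] [InnerProductSpace ℝ E]

/-- The densities `‖wₖ‖²` (at index `2k`) and `‖wₖ'‖² + V‖wₖ‖²` (at index `2k + 1`). -/
noncomputable def chainDensity (V : ℝ → ℝ) (w : ℕ → ℝ → E) (j : ℕ) (t : ℝ) : ℝ :=
  if Even j then ‖w (j / 2) t‖ ^ 2
  else ‖deriv (w (j / 2)) t‖ ^ 2 + V t * ‖w (j / 2) t‖ ^ 2

lemma chainDensity_even (V : ℝ → ℝ) (w : ℕ → ℝ → E) (k : ℕ) (t : ℝ) :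
    chainDensity V w (2 * k) t = ‖w k t‖ ^ 2 := by
  simp [chainDensity]

lemma chainDensity_odd (V : ℝ → ℝ) (w : ℕ → ℝ → E) (k : ℕ) (t : ℝ) :
    chainDensity V w (2 * k + 1) t = ‖deriv (w k) t‖ ^ 2 + V t * ‖w k t‖ ^ 2 := by
  have h : (2 * k + 1) / 2 = k := by omega
  simp [chainDensity, h]

variable {V : ℝ → ℝ} {w : ℕ → ℝ → E}

lemma chainDensity_nonneg (hV0 : ∀ t, 0 ≤ V t) (j : ℕ) (t : ℝ) : 0 ≤ chainDensity V w j t := by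
  have := hV0 t
  unfold chainDensity
  split_ifs <;> positivity

lemma continuous_chainDensity (hV : Continuous V) (hw : ∀ k, ContDiff ℝ 2 (w k)) (j : ℕ) :
    Continuous (chainDensity V w j) := by
  have h1 := (hw (j / 2)).continuous
  have h2 := (hw (j / 2)).continuous_deriv (by norm_num)
  unfold chainDensity
  split_ifs <;> fun_prop

lemma integrable_cutoff_chainDensity {χ : ℝ → ℝ} (hχ : Continuous χ) (hc : HasCompactSupport χ)
    (hV : Continuous V) (hw : ∀ k, ContDiff ℝ 2 (w k)) (hL2 : Integrable fun t => ‖w 0 t‖ ^ 2)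
    (j : ℕ) : Integrable fun t => (χ t ^ j) ^ 2 * chainDensity V w j t := by
  have h := continuous_chainDensity hV hw j
  cases j with
  | zero => simpa [chainDensity] using hL2
  | succ j => exact integrable_of_support_le hc (by fun_prop) fun t ht => by simp [ht]

/-- Each weighted density in a chain `wₖ'' = V wₖ + wₖ₊₁` is interpolated between its
neighbours. -/
lemma integral_chainDensity_succ_le {χ : ℝ → ℝ} {C : ℝ} (hχ : ContDiff ℝ 1 χ)
    (hc : HasCompactSupport χ) (hC : ∀ t, |deriv χ t| ≤ C) (hV : Continuous V)
    (hV0 : ∀ t, 0 ≤ V t) (hw : ∀ k, ContDiff ℝ 2 (w k))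
    (heq : ∀ k t, deriv (deriv (w k)) t = V t • w k t + w (k + 1) t)
    (hL2 : Integrable fun t => ‖w 0 t‖ ^ 2) (j : ℕ) {ε : ℝ} (hε : 0 < ε) :
    ∫ t, (χ t ^ (j + 1)) ^ 2 * chainDensity V w (j + 1) t ≤
      ε * (∫ t, (χ t ^ (j + 2)) ^ 2 * chainDensity V w (j + 2) t) +
        (ε⁻¹ + 4 * (j + 1) ^ 2 * C ^ 2) * ∫ t, (χ t ^ j) ^ 2 * chainDensity V w j t := by
  have hint := integrable_cutoff_chainDensity hχ.continuous hc hV hw hL2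
  rw [← integral_const_mul, ← integral_const_mul,
    ← integral_add ((hint _).const_mul _) ((hint _).const_mul _)]
  have hη : ContDiff ℝ 1 fun t => χ t ^ (j + 1) := hχ.pow _
  have hηc : HasCompactSupport fun t => χ t ^ (j + 1) :=
    hc.mono fun t ht h0 => ht (by simp [h0])
  have hd : ∀ t, deriv (fun t => χ t ^ (j + 1)) t = (j + 1) * χ t ^ j * deriv χ t := fun t => by
    have := ((hχ.differentiable one_ne_zero t).hasDerivAt.fun_pow (j + 1)).deriv
    simpa using this
  have hd2 : ∀ t, 4 * deriv (fun t => χ t ^ (j + 1)) t ^ 2 ≤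
      4 * (j + 1) ^ 2 * C ^ 2 * (χ t ^ j) ^ 2 := fun t => by
    have h1 : deriv χ t ^ 2 ≤ C ^ 2 := sq_le_sq.2 ((hC t).trans (le_abs_self C))
    rw [hd]
    calc 4 * ((j + 1) * χ t ^ j * deriv χ t) ^ 2
        = 4 * (j + 1 : ℝ) ^ 2 * (χ t ^ j) ^ 2 * deriv χ t ^ 2 := by ring
      _ ≤ 4 * (j + 1 : ℝ) ^ 2 * (χ t ^ j) ^ 2 * C ^ 2 := by gcongr
      _ = _ := by ring
  have young : ∀ t x y : ℝ, 2 * (χ t ^ (j + 1)) ^ 2 * (x * y) ≤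
      ε * ((χ t ^ (j + 2)) ^ 2 * x ^ 2) + ε⁻¹ * ((χ t ^ j) ^ 2 * y ^ 2) := fun t x y => by
    have h1 := two_mul_le_add_mul_sq (a := χ t ^ (j + 2) * x) (b := χ t ^ j * y) hε
    calc _ = 2 * (χ t ^ (j + 2) * x) * (χ t ^ j * y) := by ring
      _ ≤ _ := h1
      _ = _ := by ring
  have hint2 := ((hint (j + 2)).const_mul ε).add
    ((hint j).const_mul (ε⁻¹ + 4 * (j + 1) ^ 2 * C ^ 2))
  obtain ⟨k, rfl | rfl⟩ := Nat.even_or_odd' j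
  · have h2 : 2 * k + 2 = 2 * (k + 1) := by ring
    simp only [h2, chainDensity_even, chainDensity_odd] at hint2 young ⊢
    refine integral_energy_le hη hηc hV (hw k) (heq k) hint2 (fun t => ?_) hV0
    have h3 := young t ‖w (k + 1) t‖ ‖w k t‖
    have h4 := mul_le_mul_of_nonneg_right (hd2 t) (sq_nonneg ‖w k t‖)
    linarith
  · have h2 : 2 * k + 1 + 2 = 2 * (k + 1) + 1 := by ring
    have h1 : 2 * k + 1 + 1 = 2 * (k + 1) := by ring
    simp only [h2, h1, chainDensity_even, chainDensity_odd] at hint2 young hη hηc hd2 ⊢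
    refine integral_source_le hη hηc (hw k) ((hw (k + 1)).of_le (by norm_num)) (heq k) hint2
      (fun t => ?_) hV0
    have h3 := young t ‖deriv (w (k + 1)) t‖ ‖deriv (w k) t‖
    have h3' := mul_le_mul_of_nonneg_left (young t ‖w (k + 1) t‖ ‖w k t‖) (hV0 t)
    have h4 := mul_le_mul_of_nonneg_right (hd2 t) (sq_nonneg ‖deriv (w k) t‖)
    have h5 : 0 ≤ 4 * ((2 * k + 1 : ℕ) + 1 : ℝ) ^ 2 * C ^ 2 * (χ t ^ (2 * k + 1)) ^ 2 *
        (V t * ‖w k t‖ ^ 2) := by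
      have := hV0 t
      positivity
    linarith

/-- If `w₀` is square-integrable and dominates some `w_M`, then all densities up to index `2M` are
integrable. -/
lemma integrable_chainDensity (hV : Continuous V) (hV0 : ∀ t, 0 ≤ V t)
    (hw : ∀ k, ContDiff ℝ 2 (w k))
    (heq : ∀ k t, deriv (deriv (w k)) t = V t • w k t + w (k + 1) t)
    (hL2 : Integrable fun t => ‖w 0 t‖ ^ 2) {M : ℕ} {D : ℝ} (hM : ∀ t, ‖w M t‖ ≤ D * ‖w 0 t‖)
    {j : ℕ} (hj : j ≤ 2 * M) : Integrable (chainDensity V w j) := by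
  obtain ⟨C, hC⟩ := exists_cutoff
  choose χ hχ hχc hχ0 hχ1 hχR hχC using fun R : {R : ℝ // 1 ≤ R} => hC R R.2
  set Y : {R : ℝ // 1 ≤ R} → ℕ → ℝ := fun R j => ∫ t, (χ R t ^ j) ^ 2 * chainDensity V w j t with hY
  have hY0 : ∀ R, Y R 0 = ∫ t, ‖w 0 t‖ ^ 2 := fun R => by simp [hY, chainDensity]
  obtain ⟨K, hK⟩ := exists_bound_of_interpolation (Y := Y) (K := fun j => 4 * (j + 1) ^ 2 * C ^ 2)
    (fun j => by positivity)
    (fun R j ε hε => integral_chainDensity_succ_le (hχ R) (hχc R) (hχC R) hV hV0 hw heq hL2 j hε)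
    (M := 2 * M) (D := D ^ 2) (fun R => by
      rw [hY0, ← integral_const_mul]
      refine integral_mono (integrable_cutoff_chainDensity (hχ R).continuous (hχc R) hV hw hL2 _)
        (hL2.const_mul _) fun t => ?_
      simp only [chainDensity_even]
      have h1 : (χ R t ^ (2 * M)) ^ 2 ≤ 1 :=
        pow_le_one₀ (pow_nonneg (hχ0 R t) _) (pow_le_one₀ (hχ0 R t) (hχ1 R t))
      calc _ ≤ 1 * (D * ‖w 0 t‖) ^ 2 := by
            gcongr
            exact hM t
        _ = _ := by ring) hj
  refine integrable_of_cutoff (continuous_chainDensity hV hw j) (chainDensity_nonneg hV0 j)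
    (B := K * ∫ t, ‖w 0 t‖ ^ 2) fun R hR => ⟨fun t => (χ ⟨R, hR⟩ t ^ j) ^ 2, fun t => sq_nonneg _,
      fun t ht => by simp [hχR ⟨R, hR⟩ t ht],
      integrable_cutoff_chainDensity (hχ _).continuous (hχc _) hV hw hL2 _, ?_⟩
  have h := hK ⟨R, hR⟩
  rwa [hY0] at h

/-- Polynomial weights on `w` and `h = w'' - V w` carry over to the energy density of `w`. -/
lemma integrable_pow_mul_energy {w h : ℝ → E} (hV : Continuous V) (hV0 : ∀ t, 0 ≤ V t)
    (hw : ContDiff ℝ 2 w) (heq : ∀ t, deriv (deriv w) t = V t • w t + h t) (p : ℕ)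
    (h1 : Integrable fun t => (t ^ p) ^ 2 * ‖w t‖ ^ 2)
    (h2 : Integrable fun t => (t ^ (p - 1)) ^ 2 * ‖w t‖ ^ 2)
    (h3 : Integrable fun t => (t ^ p) ^ 2 * ‖h t‖ ^ 2) :
    Integrable fun t => (t ^ p) ^ 2 * (‖deriv w t‖ ^ 2 + V t * ‖w t‖ ^ 2) := by
  obtain ⟨C, hC⟩ := exists_cutoff
  have c1 := hw.continuous
  have c2 := hw.continuous_deriv (by norm_num)
  have hB := (h3.add (h1.const_mul (1 + 8 * C ^ 2))).add (h2.const_mul (8 * p ^ 2))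
  refine integrable_of_cutoff (by fun_prop) (fun t => ?_) (B := ∫ t : ℝ,
    ((t ^ p) ^ 2 * ‖h t‖ ^ 2 + (1 + 8 * C ^ 2) * ((t ^ p) ^ 2 * ‖w t‖ ^ 2) +
      8 * p ^ 2 * ((t ^ (p - 1)) ^ 2 * ‖w t‖ ^ 2))) fun R hR => ?_
  · have := hV0 t
    positivity
  obtain ⟨χ, hχ, hχc, hχ0, hχ1, hχR, hχC⟩ := hC R hR
  have c3 := hχ.continuous
  refine ⟨fun t => χ t ^ 2, fun t => sq_nonneg _, fun t ht => by simp [hχR t ht],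
    integrable_of_support_le hχc (by fun_prop) fun t ht => by simp [ht], ?_⟩
  have hη : ContDiff ℝ 1 fun t => χ t * t ^ p := hχ.mul (contDiff_id.pow p)
  have hηc : HasCompactSupport fun t => χ t * t ^ p :=
    hχc.mono fun t ht h0 => ht (by simp [h0])
  have key := integral_energy_le hη hηc hV hw heq hB (fun t => ?_) hV0
  · simpa only [mul_pow, mul_assoc, Pi.add_apply] using key
  have hd : deriv (fun t => χ t * t ^ p) t = deriv χ t * t ^ p + χ t * (p * t ^ (p - 1)) :=
    ((hχ.differentiable one_ne_zero t).hasDerivAt.mul (hasDerivAt_pow p t)).deriv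
  have e1 : deriv χ t ^ 2 ≤ C ^ 2 := sq_le_sq.2 ((hχC t).trans (le_abs_self C))
  have e2 : χ t ^ 2 ≤ 1 := pow_le_one₀ (hχ0 t) (hχ1 t)
  have e3 : deriv (fun t => χ t * t ^ p) t ^ 2 ≤
      2 * C ^ 2 * (t ^ p) ^ 2 + 2 * p ^ 2 * (t ^ (p - 1)) ^ 2 := by
    rw [hd]
    calc _ ≤ 2 * ((deriv χ t * t ^ p) ^ 2 + (χ t * (p * t ^ (p - 1))) ^ 2) := add_sq_le
      _ = 2 * (deriv χ t ^ 2 * (t ^ p) ^ 2 + χ t ^ 2 * (p * t ^ (p - 1)) ^ 2) := by ring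
      _ ≤ 2 * (C ^ 2 * (t ^ p) ^ 2 + 1 * (p * t ^ (p - 1)) ^ 2) := by gcongr
      _ = _ := by ring
  have e4 := mul_le_mul_of_nonneg_right e3 (sq_nonneg ‖w t‖)
  have e5 : 2 * (χ t * t ^ p) ^ 2 * (‖h t‖ * ‖w t‖) ≤
      (t ^ p) ^ 2 * (‖h t‖ ^ 2 + ‖w t‖ ^ 2) := by
    calc _ = χ t ^ 2 * ((t ^ p) ^ 2 * (2 * ‖h t‖ * ‖w t‖)) := by ring
      _ ≤ 1 * ((t ^ p) ^ 2 * (‖h t‖ ^ 2 + ‖w t‖ ^ 2)) := by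
        gcongr
        exact two_mul_le_add_sq _ _
      _ = _ := one_mul _
  simp only [Pi.add_apply]
  linarith

/-- If `V` grows at least quadratically, square-integrability of all terms of a chain
`wₖ'' = V wₖ + wₖ₊₁` improves to square-integrability against all powers. -/
lemma integrable_pow_mul_chain {a A : ℝ} (ha : 0 < a) (hV : Continuous V)
    (hV0 : ∀ t, 0 ≤ V t) (hVa : ∀ t, a * t ^ 2 ≤ V t + A) (hw : ∀ k, ContDiff ℝ 2 (w k))
    (heq : ∀ k t, deriv (deriv (w k)) t = V t • w k t + w (k + 1) t)
    (hL2 : ∀ k, Integrable fun t => ‖w k t‖ ^ 2) (p : ℕ) :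
    ∀ k, Integrable fun t : ℝ => (t ^ p) ^ 2 * ‖w k t‖ ^ 2 := by
  induction p using Nat.strong_induction_on with
  | _ p ih =>
    intro k
    cases p with
    | zero => simpa using hL2 k
    | succ p =>
      have c1 := (hw k).continuous
      have h1 := ih p p.lt_succ_self
      have h2 := integrable_pow_mul_energy hV hV0 (hw k) (heq k) p (h1 k)
        (ih (p - 1) (by omega) k) (h1 (k + 1))
      refine ((h2.add ((h1 k).const_mul A)).const_mul a⁻¹).mono' (by fun_prop)
        (Filter.Eventually.of_forall fun t => ?_)
      rw [Real.norm_of_nonneg (by positivity)]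
      have h3 := mul_le_mul_of_nonneg_right (hVa t)
        (by positivity : 0 ≤ (t ^ p) ^ 2 * ‖w k t‖ ^ 2)
      have h4 : 0 ≤ (t ^ p) ^ 2 * ‖deriv (w k) t‖ ^ 2 := by positivity
      simp only [Pi.add_apply]
      rw [le_inv_mul_iff₀ ha]
      calc _ = a * t ^ 2 * ((t ^ p) ^ 2 * ‖w k t‖ ^ 2) := by ring
        _ ≤ _ := by linarith

/-- Under the assumptions of `integrable_pow_mul_chain` the derivatives are square-integrable
against all powers as well. -/
lemma integrable_pow_mul_deriv_chain {a A : ℝ} (ha : 0 < a) (hV : Continuous V)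
    (hV0 : ∀ t, 0 ≤ V t) (hVa : ∀ t, a * t ^ 2 ≤ V t + A) (hw : ∀ k, ContDiff ℝ 2 (w k))
    (heq : ∀ k t, deriv (deriv (w k)) t = V t • w k t + w (k + 1) t)
    (hL2 : ∀ k, Integrable fun t => ‖w k t‖ ^ 2) (p k : ℕ) :
    Integrable fun t : ℝ => (t ^ p) ^ 2 * ‖deriv (w k) t‖ ^ 2 := by
  have h := integrable_pow_mul_chain ha hV hV0 hVa hw heq hL2
  have c2 := (hw k).continuous_deriv (by norm_num)
  refine (integrable_pow_mul_energy hV hV0 (hw k) (heq k) p (h p k) (h (p - 1) k)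
    (h p (k + 1))).mono' (by fun_prop) (Filter.Eventually.of_forall fun t => ?_)
  rw [Real.norm_of_nonneg (by positivity)]
  have h4 : 0 ≤ (t ^ p) ^ 2 * (V t * ‖w k t‖ ^ 2) := by
    have := hV0 t
    positivity
  linarith

end Chain

/-- The functions generated by the `wₖ` and their derivatives under addition and multiplication by
polynomials. -/
inductive PolySpan (w : ℕ → ℝ → ℂ) : (ℝ → ℂ) → Prop
  | base (k : ℕ) : PolySpan w (w k)
  | base_deriv (k : ℕ) : PolySpan w (deriv (w k))
  | add {f g : ℝ → ℂ} : PolySpan w f → PolySpan w g → PolySpan w (fun t => f t + g t)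
  | const_mul (c : ℂ) {f : ℝ → ℂ} : PolySpan w f → PolySpan w (fun t => c * f t)
  | id_mul {f : ℝ → ℂ} : PolySpan w f → PolySpan w (fun t => (t : ℂ) * f t)

namespace PolySpan

variable {w : ℕ → ℝ → ℂ} {f : ℝ → ℂ}

lemma contDiff (hw : ∀ k, ContDiff ℝ (⊤ : ℕ∞) (w k)) (hf : PolySpan w f) :
    ContDiff ℝ (⊤ : ℕ∞) f := by
  induction hf with
  | base k => exact hw k
  | base_deriv k => exact (contDiff_infty_iff_deriv.1 (hw k)).2
  | add _ _ hf hg => exact hf.add hg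
  | const_mul c _ hf => exact contDiff_const.mul hf
  | id_mul _ hf => exact Complex.ofRealCLM.contDiff.mul hf

lemma pow_mul (hf : PolySpan w f) (n : ℕ) : PolySpan w fun t => (t : ℂ) ^ n * f t := by
  induction n with
  | zero => simpa using hf
  | succ n ih => simpa only [pow_succ', mul_assoc] using ih.id_mul

lemma deriv {b : ℂ} {n : ℕ} (hw : ∀ k, ContDiff ℝ (⊤ : ℕ∞) (w k))
    (heq : ∀ k t, deriv (deriv (w k)) t = b * ((t : ℂ) ^ n * w k t) + w (k + 1) t)
    (hf : PolySpan w f) : PolySpan w (deriv f) := by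
  have hd : ∀ {f}, PolySpan w f → Differentiable ℝ f := fun hf =>
    (hf.contDiff hw).differentiable (by simp)
  induction hf with
  | base k => exact base_deriv k
  | base_deriv k =>
    rw [funext (heq k)]
    exact (((base k).pow_mul n).const_mul b).add (base (k + 1))
  | add hf hg hf' hg' =>
    convert hf'.add hg' using 2 with t
    exact deriv_fun_add (hd hf t) (hd hg t)
  | const_mul c hf hf' =>
    convert hf'.const_mul c using 2 with t
    exact deriv_const_mul_field c
  | id_mul hf hf' =>
    convert hf.add hf'.id_mul using 2 with t
    have h := (Complex.ofRealCLM.hasDerivAt (x := t)).fun_mul (hd hf t).hasDerivAt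
    simpa using h.deriv

lemma iteratedDeriv {b : ℂ} {n : ℕ} (hw : ∀ k, ContDiff ℝ (⊤ : ℕ∞) (w k))
    (heq : ∀ k t, _root_.deriv (_root_.deriv (w k)) t = b * ((t : ℂ) ^ n * w k t) + w (k + 1) t)
    (hf : PolySpan w f) (q : ℕ) : PolySpan w (iteratedDeriv q f) := by
  induction q with
  | zero => simpa using hf
  | succ q ih =>
    rw [iteratedDeriv_succ]
    exact ih.deriv hw heq

lemma integrable_pow_mul (hw : ∀ k, ContDiff ℝ (⊤ : ℕ∞) (w k))
    (h0 : ∀ p k, Integrable fun t : ℝ => (t ^ p) ^ 2 * ‖w k t‖ ^ 2)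
    (h1 : ∀ p k, Integrable fun t : ℝ => (t ^ p) ^ 2 * ‖_root_.deriv (w k) t‖ ^ 2)
    (hf : PolySpan w f) (p : ℕ) : Integrable fun t : ℝ => (t ^ p) ^ 2 * ‖f t‖ ^ 2 := by
  induction hf generalizing p with
  | base k => exact h0 p k
  | base_deriv k => exact h1 p k
  | @add f g hf hg hf' hg' =>
    have c1 := (hf.contDiff hw).continuous
    have c2 := (hg.contDiff hw).continuous
    refine (((hf' p).const_mul 2).add ((hg' p).const_mul 2)).mono' (by fun_prop)
      (Filter.Eventually.of_forall fun t => ?_)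
    rw [Real.norm_of_nonneg (by positivity)]
    have h2 : ‖f t + g t‖ ^ 2 ≤ 2 * (‖f t‖ ^ 2 + ‖g t‖ ^ 2) :=
      (pow_le_pow_left₀ (norm_nonneg _) (norm_add_le _ _) 2).trans add_sq_le
    have h3 := mul_le_mul_of_nonneg_left h2 (sq_nonneg (t ^ p))
    simp only [Pi.add_apply]
    linarith
  | const_mul c _ hf' =>
    refine ((hf' p).const_mul (‖c‖ ^ 2)).congr (Filter.Eventually.of_forall fun t => ?_)
    simp only [norm_mul]
    ring
  | id_mul _ hf' =>
    refine (hf' (p + 1)).congr (Filter.Eventually.of_forall fun t => ?_)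
    simp only [norm_mul, Complex.norm_real, Real.norm_eq_abs, mul_pow, sq_abs]
    ring

end PolySpan

/-- A smooth function that is square-integrable together with its derivative is bounded. -/
lemma exists_norm_le_of_integrable_sq {E : Type*} [NormedAddCommGroup E] [InnerProductSpace ℝ E]
    {f : ℝ → E} (hf : ContDiff ℝ 1 f) (h0 : Integrable fun t => ‖f t‖ ^ 2)
    (h1 : Integrable fun t => ‖deriv f t‖ ^ 2) : ∃ C, ∀ t, ‖f t‖ ≤ C := by
  have c0 := hf.continuous
  have c1 := hf.continuous_deriv le_rfl
  set I := ∫ t, (‖f t‖ ^ 2 + ‖deriv f t‖ ^ 2)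
  refine ⟨√(‖f 0‖ ^ 2 + I), fun t => Real.le_sqrt_of_sq_le ?_⟩
  have hle : ∀ s, ‖2 * inner ℝ (f s) (deriv f s)‖ ≤ ‖f s‖ ^ 2 + ‖deriv f s‖ ^ 2 := fun s => by
    rw [norm_mul, Real.norm_two]
    calc 2 * ‖inner ℝ (f s) (deriv f s)‖ ≤ 2 * (‖f s‖ * ‖deriv f s‖) := by
          gcongr
          exact norm_inner_le_norm _ _
      _ = 2 * ‖f s‖ * ‖deriv f s‖ := by ring
      _ ≤ _ := two_mul_le_add_sq _ _
  have hFTC := intervalIntegral.integral_eq_sub_of_hasDerivAt (a := 0) (b := t)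
    (fun s _ => (hf.differentiable one_ne_zero s).hasDerivAt.norm_sq)
    (Continuous.intervalIntegrable (by fun_prop) _ _)
  have h2 : ‖∫ s in (0 : ℝ)..t, 2 * inner ℝ (f s) (deriv f s)‖ ≤ I := by
    refine intervalIntegral.norm_integral_le_integral_norm_uIoc.trans ?_
    calc _ ≤ ∫ s in Set.uIoc 0 t, (‖f s‖ ^ 2 + ‖deriv f s‖ ^ 2) := by
          refine integral_mono_of_nonneg (Filter.Eventually.of_forall fun s => norm_nonneg _)
            (h0.add h1).integrableOn (Filter.Eventually.of_forall hle)
      _ ≤ I := setIntegral_le_integral (h0.add h1)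
            (Filter.Eventually.of_forall fun s => by
              simp only [Pi.zero_apply]; positivity)
  rw [hFTC] at h2
  have h3 := (abs_le.1 h2).2
  linarith

section LopIterates

variable {N : ℕ} {b : ℝ} {f : ℝ → ℂ}

lemma contDiff_Lop (hf : ContDiff ℝ (⊤ : ℕ∞) f) : ContDiff ℝ (⊤ : ℕ∞) (Lop N b f) := by
  refine ContDiff.sub ?_ (ContDiff.mul ?_ hf)
  · exact (contDiff_infty_iff_deriv.1 (contDiff_infty_iff_deriv.1 hf).2).2
  · exact Complex.ofRealCLM.contDiff.comp (contDiff_const.mul (contDiff_id.pow _))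

lemma contDiff_iterate_Lop (hf : ContDiff ℝ (⊤ : ℕ∞) f) (k : ℕ) :
    ContDiff ℝ (⊤ : ℕ∞) ((Lop N b)^[k] f) := by
  induction k with
  | zero => exact hf
  | succ k ih =>
    rw [Function.iterate_succ_apply']
    exact contDiff_Lop ih

lemma Lop_const_mul (c : ℂ) (f : ℝ → ℂ) :
    Lop N b (fun t => c * f t) = fun t => c * Lop N b f t := by
  have h : ∀ g : ℝ → ℂ, deriv (fun t => c * g t) = fun t => c * deriv g t := fun g =>
    funext fun t => deriv_const_mul_field c
  funext t
  simp only [Lop, h]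
  ring

lemma iterate_Lop_const_mul (c : ℂ) (f : ℝ → ℂ) (k : ℕ) :
    (Lop N b)^[k] (fun t => c * f t) = fun t => c * (Lop N b)^[k] f t := by
  induction k with
  | zero => rfl
  | succ k ih => simp only [Function.iterate_succ_apply', ih, Lop_const_mul]

lemma iterate_Lop_mul {c : ℂ} {M : ℕ} (h : ∀ t, (Lop N b)^[M] f t = c * f t) (m : ℕ) :
    (Lop N b)^[M * m] f = fun t => c ^ m * f t := by
  induction m with
  | zero => simp
  | succ m ih =>
    rw [Nat.mul_succ, Function.iterate_add_apply, funext h, iterate_Lop_const_mul, ih]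
    funext t
    ring

end LopIterates

/-- If `u` is smooth, square-integrable, and satisfies `L^N u = c·u`, then `u` is a Schwartz
function. -/
theorem stmt_17 (N : ℕ) (hN : 2 ≤ N) (b : ℝ) (hb : b ≠ 0) (c : ℂ) (u : ℝ → ℂ)
    (hu : ContDiff ℝ (⊤ : ℕ∞) u)
    (hL2 : MeasureTheory.Integrable (fun t => ‖u t‖ ^ 2))
    (heq : ∀ t : ℝ, (Lop N b)^[N] u t = c * u t) :
    ∀ p q : ℕ, ∃ C : ℝ, ∀ t : ℝ, |t| ^ p * ‖iteratedDeriv q u t‖ ≤ C := by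
  set w : ℕ → ℝ → ℂ := fun k => (Lop N b)^[k] u with hw_def
  set V : ℝ → ℝ := fun t => b ^ 2 * t ^ (2 * (N - 1)) with hV_def
  have hw : ∀ k, ContDiff ℝ (⊤ : ℕ∞) (w k) := contDiff_iterate_Lop hu
  have hw2 : ∀ k, ContDiff ℝ 2 (w k) := fun k => contDiff_infty.1 (hw k) 2
  have hV : Continuous V := by fun_prop
  have hV0 : ∀ t, 0 ≤ V t := fun t =>
    mul_nonneg (sq_nonneg b) ((even_two_mul _).pow_nonneg t)
  have hVb : ∀ t, b ^ 2 * t ^ 2 ≤ V t + b ^ 2 := fun t => by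
    have h1 : t ^ 2 ≤ t ^ (2 * (N - 1)) + 1 := by
      rw [pow_mul]
      rcases le_total (t ^ 2) 1 with h | h
      · have : 0 ≤ (t ^ 2) ^ (N - 1) := by positivity
        linarith
      · have := le_self_pow₀ h (show N - 1 ≠ 0 by omega)
        linarith
    have h2 := mul_le_mul_of_nonneg_left h1 (sq_nonneg b)
    simp only [hV_def]
    linarith
  have hLw : ∀ k, w (k + 1) = Lop N b (w k) := fun k => Function.iterate_succ_apply' _ _ _
  have hweq : ∀ k t, deriv (deriv (w k)) t = V t • w k t + w (k + 1) t := fun k t => by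
    rw [hLw, Lop, Complex.real_smul]
    ring
  have hweq' : ∀ k t, deriv (deriv (w k)) t =
      ((b ^ 2 : ℝ) : ℂ) * ((t : ℂ) ^ (2 * (N - 1)) * w k t) + w (k + 1) t := fun k t => by
    rw [hweq, Complex.real_smul]
    simp only [hV_def]
    push_cast
    ring
  have hwL2 : ∀ k, Integrable fun t => ‖w k t‖ ^ 2 := fun k => by
    have hM : ∀ t, ‖w (N * k) t‖ ≤ ‖c ^ k‖ * ‖w 0 t‖ := fun t => by
      simp only [hw_def, iterate_Lop_mul heq k, norm_mul, Function.iterate_zero, id_eq, le_refl]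
    have hk : 2 * k ≤ 2 * (N * k) := by nlinarith
    simpa only [chainDensity_even] using
      (integrable_chainDensity hV hV0 hw2 hweq hL2 hM hk).congr
        (Filter.Eventually.of_forall fun t => chainDensity_even V w k t)
  have hb2 : 0 < b ^ 2 := by positivity
  have hP := integrable_pow_mul_chain hb2 hV hV0 hVb hw2 hweq hwL2
  have hP' := integrable_pow_mul_deriv_chain hb2 hV hV0 hVb hw2 hweq hwL2
  intro p q
  have hq : PolySpan w fun t => (t : ℂ) ^ p * iteratedDeriv q u t :=
    ((PolySpan.base (w := w) 0).iteratedDeriv hw hweq' q).pow_mul p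
  have hq' := hq.deriv hw hweq'
  obtain ⟨C, hC⟩ := exists_norm_le_of_integrable_sq
    ((hq.contDiff hw).of_le (by exact_mod_cast le_top))
    (by simpa using hq.integrable_pow_mul hw hP hP' 0)
    (by simpa using hq'.integrable_pow_mul hw hP hP' 0)
  exact ⟨C, fun t => by simpa using hC t⟩
end
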